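/- (1) For every a ∈ M₁ and every b ∈ M \ M₁, dpt(ab) = dpt(ba) = dpt(b). (2) For every a ∈ Θ and every b ∈ M \ M₁, dpt(ab) = dpt(ba) = dpt(a) + dpt(b) − 1. -/

import Mathlib

namespace GarsideOrder

variable {G : Type*} [Group G]

/-- `a ≤_R b` iff `b * a⁻¹ ∈ M`. -/
def leR (M : Submonoid G) (a b : G) : Prop := b * a⁻¹ ∈ M

/-- `a ≤_L b` iff `a⁻¹ * b ∈ M`. -/
def leL (M : Submonoid G) (a b : G) : Prop := a⁻¹ * b ∈ M

/-- Right divisors (in `M`) of `a`. -/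
def DivR (M : Submonoid G) (a : G) : Set G := {b : G | b ∈ M ∧ leR M b a}

/-- Left divisors (in `M`) of `a`. -/
def DivL (M : Submonoid G) (a : G) : Set G := {b : G | b ∈ M ∧ leL M b a}

/-- `a` is balanced if its sets of right and left divisors coincide. -/
def Balanced (M : Submonoid G) (a : G) : Prop := DivR M a = DivL M a

open Classical in
/-- The `N`-tail of `a`: the unique `b ∈ N` having the same right divisors lying in `N`
as `a` (w.r.t. the divisibility of the ambient monoid `M`). -/
noncomputable def tail (M N : Submonoid G) (a : G) : G :=
  if h : ∃ b : G, b ∈ N ∧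
      {c : G | c ∈ N ∧ leR M c a} = {c : G | c ∈ N ∧ leR M c b} then
    h.choose
  else 1

/-- Iterated stripping of alternating tails: first the `M₁`-tail, then the `N`-tail, etc. -/
noncomputable def strip (M M₁ N : Submonoid G) : ℕ → G → G
  | 0, a => a
  | i + 1, a =>
      strip M M₁ N i a *
        (tail M (if i % 2 = 0 then M₁ else N) (strip M M₁ N i a))⁻¹

/-- The breadth of `a`: the length of the alternating form of `a`, i.e. the least `p ≥ 1`
such that stripping alternating tails `p` times reaches `1`. -/
noncomputable def bh (M M₁ N : Submonoid G) (a : G) : ℕ :=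
  sInf {p : ℕ | 1 ≤ p ∧ strip M M₁ N p a = 1}

/-- The depth of `a`: `(bh a - 1)/2` if `bh a` is odd, `bh a / 2` if `bh a` is even;
in both cases this is `bh a / 2` with natural division. -/
noncomputable def dpt (M M₁ N : Submonoid G) (a : G) : ℕ := bh M M₁ N a / 2

/-- `a ∈ M` is unmovable if `Δ` does not right-divide it. -/
def Unmovable (M : Submonoid G) (Δ a : G) : Prop := a ∈ M ∧ ¬ leR M Δ a

/-- `α` is `(H, G₁)`-negative: its `Δ`-form is `a Δ^{-k}` with `k ≥ 1` and
`dpt a < dpt (Δ^k)`. -/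
def Negative (M M₁ N : Submonoid G) (Δ : G) (α : G) : Prop :=
  ∃ a : G, ∃ k : ℕ, Unmovable M Δ a ∧ 1 ≤ k ∧ α = a * (Δ ^ k)⁻¹ ∧
    dpt M M₁ N a < dpt M M₁ N (Δ ^ k)

/-- `α` is `(H, G₁)`-positive if `α⁻¹` is `(H, G₁)`-negative. -/
def Positive (M M₁ N : Submonoid G) (Δ : G) (α : G) : Prop :=
  Negative M M₁ N Δ α⁻¹

/-- The set `Θ` of theta elements `θ^k a₀`, `k ≥ 1`, `a₀ ∈ M₁`. -/
def thetaSet (M₁ : Submonoid G) (θ : G) : Set G :=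
  {x : G | ∃ k : ℕ, 1 ≤ k ∧ ∃ a₀ ∈ M₁, x = θ ^ k * a₀}

/-- `Θ̄ = Θ ∪ M₁`. -/
def thetaBar (M₁ : Submonoid G) (θ : G) : Set G := thetaSet M₁ θ ∪ (M₁ : Set G)

/-- Condition A with constant `ζ`: `dpt (Δ^k) = ζ k + 1` for all `k ≥ 1`. -/
def CondA (M M₁ N : Submonoid G) (Δ : G) (ζ : ℕ) : Prop :=
  ∀ k : ℕ, 1 ≤ k → dpt M M₁ N (Δ ^ k) = ζ * k + 1

/-- Condition B with constant `ζ`. -/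
def CondB (M M₁ N : Submonoid G) (Δ θ : G) (ζ : ℕ) : Prop :=
  ∀ a b c : G, ∀ t : ℤ,
    Unmovable M Δ a → Unmovable M Δ b →
    ¬(a ∈ thetaBar M₁ θ ∧ b ∈ thetaBar M₁ θ) →
    Unmovable M Δ c → a * b = c * Δ ^ t →
    ∃ ε : ℕ, ε ≤ 1 ∧
      (dpt M M₁ N c : ℤ) =
        (dpt M M₁ N a : ℤ) + (dpt M M₁ N b : ℤ) - (ζ : ℤ) * t - (ε : ℤ) ∧
      ((a ∈ thetaSet M₁ θ ∨ b ∈ thetaSet M₁ θ ∨ c ∈ M₁) → ε = 1)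

/-- A Garside structure with group of fractions the subgroup `car`. -/
structure IsGarsideOn (car : Subgroup G) (M : Submonoid G) (Δ : G) : Prop where
  M_sub : (M : Set G) ⊆ (car : Set G)
  delta_mem : Δ ∈ M
  units_trivial : ∀ x : G, x ∈ M → x⁻¹ ∈ M → x = 1
  noetherian : ∀ a ∈ M, ∃ n : ℕ, 1 ≤ n ∧ ∀ l : List G,
      (∀ x ∈ l, x ∈ M ∧ x ≠ 1) → l.prod = a → l.length ≤ n
  balanced : Balanced M Δ
  div_finite : (DivR M Δ).Finite
  div_gen_monoid : Submonoid.closure (DivR M Δ) = M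
  div_gen_group : Subgroup.closure (DivR M Δ) = car
  meet : ∀ a ∈ car, ∀ b ∈ car, ∃ c ∈ car, leR M c a ∧ leR M c b ∧
      ∀ d ∈ car, leR M d a → leR M d b → leR M d c
  join : ∀ a ∈ car, ∀ b ∈ car, ∃ c ∈ car, leR M a c ∧ leR M b c ∧
      ∀ d ∈ car, leR M a d → leR M b d → leR M c d

/-- The parabolic submonoid determined by `δ`: the submonoid generated by `Div(δ)`. -/
def parM (M : Submonoid G) (δ : G) : Submonoid G := Submonoid.closure (DivR M δ)

/-- The parabolic subgroup determined by `δ`: the subgroup generated by `Div(δ)`. -/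
def parG (M : Submonoid G) (δ : G) : Subgroup G := Subgroup.closure (DivR M δ)

/-- `δ` determines a parabolic substructure of `(G, M, Δ)`. -/
structure IsParabolic (M : Submonoid G) (Δ δ : G) : Prop where
  mem : δ ∈ M
  balanced : Balanced M δ
  div_eq : DivR M δ = DivR M Δ ∩ (parM M δ : Set G)

/-- The setting of Section 3: a Garside structure `(car, M, Δ)` together with two
parabolic substructures `(H, N, Λ)` (given by `lam`) and `(G₁, M₁, Δ₁)` (given by `δ1`),
with `N ≠ M`, `M₁ ≠ M`, `N ∪ M₁` generating `M`, `Δ` central, `Δ₁` central in `G₁`. -/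
structure Setting (G : Type*) [Group G] where
  car : Subgroup G
  M : Submonoid G
  Δ : G
  δ1 : G
  lam : G
  garside : IsGarsideOn car M Δ
  par1 : IsParabolic M Δ δ1
  parH : IsParabolic M Δ lam
  N_ne : parM M lam ≠ M
  M1_ne : parM M δ1 ≠ M
  unionGen : Submonoid.closure ((parM M lam : Set G) ∪ (parM M δ1 : Set G)) = M
  delta_central : ∀ g ∈ car, Δ * g = g * Δ
  delta1_central : ∀ g ∈ parG M δ1, δ1 * g = g * δ1

namespace Setting

variable (S : Setting G)

/-- The parabolic submonoid `M₁`. -/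
def M₁ : Submonoid G := parM S.M S.δ1

/-- The parabolic submonoid `N`. -/
def Nsub : Submonoid G := parM S.M S.lam

/-- The parabolic subgroup `G₁`. -/
def G₁ : Subgroup G := parG S.M S.δ1

/-- `θ = Δ Δ₁⁻¹`. -/
def theta : G := S.Δ * S.δ1⁻¹

/-- The set of `(H, G₁)`-negative elements. -/
def Neg : Set G := {α : G | Negative S.M S.M₁ S.Nsub S.Δ α}

/-- The set of `(H, G₁)`-positive elements. -/
def Pos : Set G := {α : G | α⁻¹ ∈ S.Neg}

/-- Condition A. -/
def condA (ζ : ℕ) : Prop := CondA S.M S.M₁ S.Nsub S.Δ ζ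

/-- Condition B. -/
def condB (ζ : ℕ) : Prop := CondB S.M S.M₁ S.Nsub S.Δ S.theta ζ

/-- `(H, G₁)` is a Dehornoy structure: `PP ⊆ P`, `G₁ P G₁ ⊆ P`, and the group is the
disjoint union of `P`, `P⁻¹` and `G₁`. -/
def IsDehornoy : Prop :=
  (∀ α ∈ S.Pos, ∀ β ∈ S.Pos, α * β ∈ S.Pos) ∧
  (∀ g₁ ∈ S.G₁, ∀ α ∈ S.Pos, ∀ g₂ ∈ S.G₁, g₁ * α * g₂ ∈ S.Pos) ∧
  (∀ α ∈ S.car, α ∈ S.Pos ∨ α ∈ S.Neg ∨ α ∈ S.G₁) ∧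
  (∀ α : G, ¬(α ∈ S.Pos ∧ α ∈ S.Neg)) ∧
  (∀ α : G, ¬(α ∈ S.Pos ∧ α ∈ S.G₁)) ∧
  (∀ α : G, ¬(α ∈ S.Neg ∧ α ∈ S.G₁))

end Setting

end GarsideOrder


namespace BraidOrder

open GarsideOrder

/-- The braid relations on `n` generators `σ_0, …, σ_{n-1}` (representing `s_1, …, s_n`). -/
def braidRel (n : ℕ) : Set (FreeGroup (Fin n)) :=
  {r | ∃ i j : Fin n,
      ((i : ℕ) + 1 = (j : ℕ) ∧
        r = FreeGroup.of i * FreeGroup.of j * FreeGroup.of i *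
            (FreeGroup.of j * FreeGroup.of i * FreeGroup.of j)⁻¹) ∨
      ((i : ℕ) + 2 ≤ (j : ℕ) ∧
        r = FreeGroup.of i * FreeGroup.of j * (FreeGroup.of j * FreeGroup.of i)⁻¹)}

/-- The braid group `B_{n+1}` on `n+1` strands, presented with `n` generators. -/
abbrev Braid (n : ℕ) := PresentedGroup (braidRel n)

/-- `gen n i` is the generator `s_{i+1}` of `B_{n+1}` (for `i < n`). -/
def gen (n i : ℕ) : Braid n :=
  if h : i < n then PresentedGroup.of ⟨i, h⟩ else 1

/-- The product `gen a * gen (a+1) * ⋯ * gen (b-1)`, i.e. `s_{a+1} s_{a+2} ⋯ s_b`. -/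
def seg (n a b : ℕ) : Braid n := (((List.range b).drop a).map (gen n)).prod

/-- The product `gen (b-1) * ⋯ * gen (a+1) * gen a`, i.e. `s_b ⋯ s_{a+2} s_{a+1}`. -/
def segRev (n a b : ℕ) : Braid n := ((((List.range b).drop a).reverse).map (gen n)).prod

/-- The positive braid monoid `B_{n+1}^+`. -/
def Mb (n : ℕ) : Submonoid (Braid n) :=
  Submonoid.closure {x : Braid n | ∃ i : ℕ, i < n ∧ x = gen n i}

/-- The submonoid generated by `s_2, …, s_n`. -/
def M₁b (n : ℕ) : Submonoid (Braid n) :=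
  Submonoid.closure {x : Braid n | ∃ i : ℕ, 1 ≤ i ∧ i < n ∧ x = gen n i}

/-- The submonoid generated by `s_1, …, s_{n-1}`. -/
def Nb (n : ℕ) : Submonoid (Braid n) :=
  Submonoid.closure {x : Braid n | ∃ i : ℕ, i + 1 < n ∧ x = gen n i}

/-- The subgroup generated by `s_2, …, s_n`. -/
def G₁b (n : ℕ) : Subgroup (Braid n) :=
  Subgroup.closure {x : Braid n | ∃ i : ℕ, 1 ≤ i ∧ i < n ∧ x = gen n i}

/-- The subgroup generated by `s_1, …, s_{n-1}`. -/
def Hb (n : ℕ) : Subgroup (Braid n) :=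
  Subgroup.closure {x : Braid n | ∃ i : ℕ, i + 1 < n ∧ x = gen n i}

/-- The Garside element `Δ = (s_1 s_2 ⋯ s_n)^{n+1}`. -/
def Δb (n : ℕ) : Braid n := seg n 0 n ^ (n + 1)

/-- `Δ₁ = (s_2 ⋯ s_n)^n`. -/
def Δ₁b (n : ℕ) : Braid n := seg n 1 n ^ n

/-- `Λ = (s_1 ⋯ s_{n-1})^n`. -/
def Λb (n : ℕ) : Braid n := seg n 0 (n - 1) ^ n

/-- `θ = s_1 ⋯ s_{n-1} s_n² s_{n-1} ⋯ s_1` as an explicit word. -/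
def thetaWordb (n : ℕ) : Braid n := seg n 0 n * segRev n 0 n

end BraidOrder

/-! ### Artin monoids of triangle-free simply laced type -/

namespace ArtinMonoid

variable {ι : Type*}

/-- The defining relations of the simply laced Artin monoid with adjacency relation `adj`. -/
inductive Rel (adj : ι → ι → Prop) : FreeMonoid ι → FreeMonoid ι → Prop
  | braid {i j : ι} (h : adj i j) : Rel adj
      (FreeMonoid.of i * (FreeMonoid.of j * FreeMonoid.of i))
      (FreeMonoid.of j * (FreeMonoid.of i * FreeMonoid.of j))
  | comm {i j : ι} (h : ¬ adj i j) : Rel adj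
      (FreeMonoid.of i * FreeMonoid.of j) (FreeMonoid.of j * FreeMonoid.of i)

/-- The simply laced Artin monoid with adjacency relation `adj`. -/
abbrev Artin (adj : ι → ι → Prop) := PresentedMonoid (Rel adj)

variable {adj : ι → ι → Prop}

/-- The generators of the Artin monoid. -/
def gen (adj : ι → ι → Prop) (i : ι) : Artin adj := PresentedMonoid.of _ i

theorem gen_braid {i j : ι} (h : adj i j) (z : Artin adj) :
    gen adj i * (gen adj j * (gen adj i * z)) = gen adj j * (gen adj i * (gen adj j * z)) := by
  have := PresentedMonoid.mk_eq_mk_of_rel (Rel.braid h)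
  simp only [map_mul] at this
  simp only [← mul_assoc] at this ⊢
  exact congrArg (· * z) this

theorem gen_comm {i j : ι} (h : ¬ adj i j) (z : Artin adj) :
    gen adj i * (gen adj j * z) = gen adj j * (gen adj i * z) := by
  have := PresentedMonoid.mk_eq_mk_of_rel (Rel.comm h)
  simp only [map_mul] at this
  simp only [← mul_assoc] at this ⊢
  exact congrArg (· * z) this

/-- The word length on the Artin monoid, as a homomorphism. -/
def lenHom (adj : ι → ι → Prop) : Artin adj →* Multiplicative ℕ :=
  PresentedMonoid.lift (fun _ => Multiplicative.ofAdd 1) (by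
    rintro a b (⟨h⟩ | ⟨h⟩) <;> simp)

/-- The word length on the Artin monoid. -/
def len (x : Artin adj) : ℕ := (lenHom adj x).toAdd

@[simp] theorem len_one : len (1 : Artin adj) = 0 := by simp [len]

@[simp] theorem len_mul (x y : Artin adj) : len (x * y) = len x + len y := by simp [len]

@[simp] theorem len_gen (i : ι) : len (gen adj i) = 1 := rfl

open Classical in
/-- The right complement of `i` in the least common right multiple of `i` and `j`. -/
noncomputable def compl (adj : ι → ι → Prop) (i j : ι) : Artin adj :=
  if i = j then 1 else if adj i j then gen adj j * gen adj i else gen adj j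

@[simp] theorem compl_self (i : ι) : compl adj i i = 1 := by simp [compl]

theorem compl_of_adj {i j : ι} (hne : i ≠ j) (h : adj i j) :
    compl adj i j = gen adj j * gen adj i := by simp [compl, hne, h]

theorem compl_of_not_adj {i j : ι} (hne : i ≠ j) (h : ¬ adj i j) :
    compl adj i j = gen adj j := by simp [compl, hne, h]

/-- Least common right multiples of generators divide all common multiples of length at most `m`. -/
def LcmUpTo (adj : ι → ι → Prop) (m : ℕ) : Prop :=
  ∀ (i j : ι) (x y : Artin adj), len (gen adj i * x) ≤ m → gen adj i * x = gen adj j * y →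
    ∃ z, x = compl adj i j * z ∧ y = compl adj j i * z

theorem LcmUpTo.cancel {m : ℕ} (H : LcmUpTo adj m) {i : ι} {x y : Artin adj}
    (hl : len (gen adj i * x) ≤ m) (h : gen adj i * x = gen adj i * y) : x = y := by
  obtain ⟨z, rfl, rfl⟩ := H i i x y hl h
  rfl

theorem LcmUpTo.of_adj {m : ℕ} (H : LcmUpTo adj m) (hs : ∀ i j, adj i j → adj j i) {i j : ι}
    (hne : i ≠ j) (ha : adj i j) {x y : Artin adj}
    (hl : len (gen adj i * x) ≤ m) (h : gen adj i * x = gen adj j * y) :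
    ∃ z, x = gen adj j * (gen adj i * z) ∧ y = gen adj i * (gen adj j * z) := by
  obtain ⟨z, h1, h2⟩ := H i j x y hl h
  rw [compl_of_adj hne ha] at h1
  rw [compl_of_adj hne.symm (hs _ _ ha)] at h2
  exact ⟨z, by rw [h1, mul_assoc], by rw [h2, mul_assoc]⟩

theorem LcmUpTo.of_not_adj {m : ℕ} (H : LcmUpTo adj m) (hs : ∀ i j, adj i j → adj j i) {i j : ι}
    (hne : i ≠ j) (ha : ¬ adj i j) {x y : Artin adj}
    (hl : len (gen adj i * x) ≤ m) (h : gen adj i * x = gen adj j * y) :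
    ∃ z, x = gen adj j * z ∧ y = gen adj i * z := by
  obtain ⟨z, h1, h2⟩ := H i j x y hl h
  rw [compl_of_not_adj hne ha] at h1
  rw [compl_of_not_adj hne.symm (fun h => ha (hs _ _ h))] at h2
  exact ⟨z, h1, h2⟩

/-- The cube condition when `k` is adjacent to `i` but not to `j`. -/
theorem cube_of_adj_of_not_adj (hs : ∀ i j, adj i j → adj j i) {m : ℕ} (H : LcmUpTo adj m)
    {i j k : ι} (hij : i ≠ j) (hik : i ≠ k) (hjk : j ≠ k) (aki : adj k i) (akj : ¬ adj k j)
    {z₁ z₂ : Artin adj} (hl : len (compl adj k i * z₁) ≤ m)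
    (h : compl adj k i * z₁ = compl adj k j * z₂) :
    ∃ z, compl adj i k * z₁ = compl adj i j * z ∧ compl adj j k * z₂ = compl adj j i * z := by
  have aik := hs _ _ aki
  have ajk : ¬ adj j k := fun h => akj (hs _ _ h)
  rw [compl_of_adj hik.symm aki] at h hl
  rw [compl_of_not_adj hjk.symm akj] at h
  rw [compl_of_adj hik aik, compl_of_not_adj hjk ajk]
  simp only [mul_assoc] at h hl ⊢
  simp only [len_mul, len_gen] at hl
  by_cases aij : adj i j
  · have aji := hs _ _ aij
    obtain ⟨w, h1, rfl⟩ := H.of_adj hs hij aij (by simp; omega) h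
    obtain ⟨v, rfl, h2⟩ := H.of_not_adj hs hjk.symm akj (by simp; omega) h1
    simp only [len_mul, len_gen] at hl
    have hl' := congrArg len h2
    simp only [len_mul, len_gen] at hl'
    obtain ⟨t, rfl, rfl⟩ := H.of_adj hs hik aik (by simp; omega) h2
    refine ⟨gen adj k * (gen adj i * (gen adj j * t)), ?_, ?_⟩
    · rw [compl_of_adj hij aij, mul_assoc, gen_braid aij, gen_comm akj, gen_braid aik,
        gen_comm akj]
    · rw [compl_of_adj hij.symm aji, mul_assoc, gen_comm ajk, gen_braid aki, gen_comm ajk,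
        gen_braid aji]
  · have aji : ¬ adj j i := fun h => aij (hs _ _ h)
    obtain ⟨w, h1, rfl⟩ := H.of_not_adj hs hij aij (by simp; omega) h
    obtain ⟨v, rfl, rfl⟩ := H.of_not_adj hs hjk.symm akj (by simp; omega) h1
    refine ⟨gen adj k * (gen adj i * v), ?_, ?_⟩
    · rw [compl_of_not_adj hij aij, gen_comm aij, gen_comm akj]
    · rw [compl_of_not_adj hij.symm aji, gen_braid aki]

/-- The cube condition when `k` is adjacent to neither `i` nor `j`. -/
theorem cube_of_not_adj (hs : ∀ i j, adj i j → adj j i) {m : ℕ} (H : LcmUpTo adj m)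
    {i j k : ι} (hij : i ≠ j) (hik : i ≠ k) (hjk : j ≠ k) (aki : ¬ adj k i) (akj : ¬ adj k j)
    {z₁ z₂ : Artin adj} (hl : len (compl adj k i * z₁) ≤ m)
    (h : compl adj k i * z₁ = compl adj k j * z₂) :
    ∃ z, compl adj i k * z₁ = compl adj i j * z ∧ compl adj j k * z₂ = compl adj j i * z := by
  have aik : ¬ adj i k := fun h => aki (hs _ _ h)
  have ajk : ¬ adj j k := fun h => akj (hs _ _ h)
  rw [compl_of_not_adj hik.symm aki] at h hl
  rw [compl_of_not_adj hjk.symm akj] at h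
  rw [compl_of_not_adj hik aik, compl_of_not_adj hjk ajk]
  obtain ⟨w, rfl, rfl⟩ := H i j _ _ hl h
  refine ⟨gen adj k * w, ?_, ?_⟩
  · by_cases aij : adj i j
    · rw [compl_of_adj hij aij, mul_assoc, mul_assoc, gen_comm akj, gen_comm aki]
    · rw [compl_of_not_adj hij aij, gen_comm akj]
  · by_cases aji : adj j i
    · rw [compl_of_adj hij.symm aji, mul_assoc, mul_assoc, gen_comm aki, gen_comm akj]
    · rw [compl_of_not_adj hij.symm aji, gen_comm aki]

/-- The cube condition when `k` is adjacent to both `i` and `j`. -/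
theorem cube_of_adj (hs : ∀ i j, adj i j → adj j i) {m : ℕ} (H : LcmUpTo adj m)
    {i j k : ι} (hij : i ≠ j) (hik : i ≠ k) (hjk : j ≠ k) (aki : adj k i) (akj : adj k j)
    (aij : ¬ adj i j)
    {z₁ z₂ : Artin adj} (hl : len (compl adj k i * z₁) ≤ m)
    (h : compl adj k i * z₁ = compl adj k j * z₂) :
    ∃ z, compl adj i k * z₁ = compl adj i j * z ∧ compl adj j k * z₂ = compl adj j i * z := by
  have aik := hs _ _ aki
  have ajk := hs _ _ akj
  have aji : ¬ adj j i := fun h => aij (hs _ _ h)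
  rw [compl_of_adj hik.symm aki] at h hl
  rw [compl_of_adj hjk.symm akj] at h
  rw [compl_of_adj hik aik, compl_of_adj hjk ajk, compl_of_not_adj hij aij,
    compl_of_not_adj hij.symm aji]
  simp only [mul_assoc] at h hl ⊢
  simp only [len_mul, len_gen] at hl
  have hl2 := congrArg len h
  simp only [len_mul, len_gen] at hl2
  obtain ⟨w, h1, h2⟩ := H.of_not_adj hs hij aij (by simp; omega) h
  obtain ⟨v, rfl, rfl⟩ := H.of_adj hs hjk.symm akj (by simp; omega) h1
  obtain ⟨v', rfl, h3⟩ := H.of_adj hs hik.symm aki (by simp; omega) h2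
  have hl3 := congrArg len h3
  simp only [len_mul, len_gen] at hl hl2 hl3
  have h4 := H.cancel (by simp; omega) h3
  obtain ⟨t, rfl, rfl⟩ := H.of_not_adj hs hij.symm aji (by simp; omega) h4
  refine ⟨gen adj k * (gen adj j * (gen adj i * (gen adj k * t))), ?_, ?_⟩
  · rw [gen_comm aij, gen_braid ajk, gen_braid aki]
  · rw [gen_comm aji, gen_comm aji, gen_braid aik, gen_braid akj]

theorem cube (hs : ∀ i j, adj i j → adj j i) (ht : ∀ i j k, adj k i → adj k j → ¬ adj i j)
    {m : ℕ} (H : LcmUpTo adj m) (i j k : ι) {z₁ z₂ : Artin adj}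
    (hl : len (compl adj k i * z₁) ≤ m) (h : compl adj k i * z₁ = compl adj k j * z₂) :
    ∃ z, compl adj i k * z₁ = compl adj i j * z ∧ compl adj j k * z₂ = compl adj j i * z := by
  by_cases hik : i = k
  · subst hik
    refine ⟨z₂, by simpa using h, rfl⟩
  by_cases hjk : j = k
  · subst hjk
    refine ⟨z₁, rfl, by simpa using h.symm⟩
  by_cases hij : i = j
  · subst hij
    refine ⟨compl adj i k * z₁, by simp, ?_⟩
    have : z₁ = z₂ := by
      by_cases aki : adj k i
      · rw [compl_of_adj (Ne.symm hik) aki, mul_assoc, mul_assoc] at h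
        rw [compl_of_adj (Ne.symm hik) aki, mul_assoc] at hl
        exact H.cancel (by simp at hl ⊢; omega) (H.cancel hl h)
      · rw [compl_of_not_adj (Ne.symm hik) aki] at h hl
        exact H.cancel hl h
    simp [this]
  by_cases aki : adj k i <;> by_cases akj : adj k j
  · exact cube_of_adj hs H hij hik hjk aki akj (ht _ _ _ aki akj) hl h
  · exact cube_of_adj_of_not_adj hs H hij hik hjk aki akj hl h
  · obtain ⟨z, h1, h2⟩ := cube_of_adj_of_not_adj hs H (Ne.symm hij) hjk hik akj aki
      (h ▸ hl) h.symm
    exact ⟨z, h2, h1⟩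
  · exact cube_of_not_adj hs H hij hik hjk aki akj hl h

theorem of_mul_inj {i j : ι} {x y : FreeMonoid ι}
    (h : FreeMonoid.of i * x = FreeMonoid.of j * y) : i = j ∧ x = y := by
  have := congrArg FreeMonoid.toList h
  simp only [FreeMonoid.toList_mul, FreeMonoid.toList_of, List.singleton_append,
    List.cons.injEq] at this
  exact ⟨this.1, FreeMonoid.toList.injective this.2⟩

theorem eq_one_or_eq_of_mul (w : FreeMonoid ι) : w = 1 ∨ ∃ i x, w = FreeMonoid.of i * x := by
  induction w using FreeMonoid.recOn with
  | one => exact Or.inl rfl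
  | of_mul i x _ => exact Or.inr ⟨i, x, rfl⟩

theorem mk_of_mul (i : ι) (x : FreeMonoid ι) :
    PresentedMonoid.mk (Rel adj) (FreeMonoid.of i * x) =
      gen adj i * PresentedMonoid.mk (Rel adj) x := map_mul _ _ _

theorem lcm_of_conGen (hs : ∀ i j, adj i j → adj j i)
    (ht : ∀ i j k, adj k i → adj k j → ¬ adj i j) (hi : ∀ i, ¬ adj i i)
    {m : ℕ} (H : LcmUpTo adj m) {w w' : FreeMonoid ι} (h : ConGen.Rel (Rel adj) w w')
    (hl : len (PresentedMonoid.mk (Rel adj) w) ≤ m + 1) {i j : ι} {x y : FreeMonoid ι}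
    (hx : w = FreeMonoid.of i * x) (hy : w' = FreeMonoid.of j * y) :
    ∃ z, PresentedMonoid.mk (Rel adj) x = compl adj i j * z ∧
      PresentedMonoid.mk (Rel adj) y = compl adj j i * z := by
  induction h generalizing i j x y with
  | of a b hab =>
    cases hab with
    | @braid a b h =>
      obtain ⟨rfl, rfl⟩ := of_mul_inj hx
      obtain ⟨rfl, rfl⟩ := of_mul_inj hy
      have hne : a ≠ b := by rintro rfl; exact hi _ h
      refine ⟨1, ?_, ?_⟩
      · rw [compl_of_adj hne h, mul_one]; rfl
      · rw [compl_of_adj hne.symm (hs _ _ h), mul_one]; rfl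
    | @comm a b h =>
      obtain ⟨rfl, rfl⟩ := of_mul_inj hx
      obtain ⟨rfl, rfl⟩ := of_mul_inj hy
      by_cases hne : a = b
      · subst hne
        exact ⟨gen adj a, by simp [gen, PresentedMonoid.of], by simp [gen, PresentedMonoid.of]⟩
      refine ⟨1, ?_, ?_⟩
      · rw [compl_of_not_adj hne h, mul_one]; rfl
      · rw [compl_of_not_adj (Ne.symm hne) (fun h' => h (hs _ _ h')), mul_one]; rfl
  | refl w =>
    subst hx
    obtain ⟨rfl, rfl⟩ := of_mul_inj hy
    exact ⟨PresentedMonoid.mk _ x, by simp, by simp⟩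
  | symm h ih =>
    have he := PresentedMonoid.mk_eq_mk_iff.2 h
    obtain ⟨z, h1, h2⟩ := ih (he ▸ hl) hy hx
    exact ⟨z, h2, h1⟩
  | @trans a b c hab hbc ih1 ih2 =>
    have he := PresentedMonoid.mk_eq_mk_iff.2 hab
    rcases eq_one_or_eq_of_mul b with rfl | ⟨k, u, rfl⟩
    · rw [hx, mk_of_mul] at he
      have := congrArg len he
      simp at this
    · obtain ⟨z₁, h1, h2⟩ := ih1 hl hx rfl
      obtain ⟨z₂, h3, h4⟩ := ih2 (he ▸ hl) rfl hy
      rw [he, mk_of_mul] at hl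
      obtain ⟨z, h5, h6⟩ := cube hs ht H i j k (z₁ := z₁) (z₂ := z₂)
        (by rw [← h2]; simp at hl; omega) (h2.symm.trans h3)
      exact ⟨z, h1.trans h5, h4.trans h6⟩
  | @mul a b c d hab hcd ih1 ih2 =>
    have he1 := PresentedMonoid.mk_eq_mk_iff.2 hab
    have he2 := PresentedMonoid.mk_eq_mk_iff.2 hcd
    rw [map_mul, len_mul] at hl
    rcases eq_one_or_eq_of_mul a with rfl | ⟨p, u, rfl⟩ <;>
      rcases eq_one_or_eq_of_mul b with rfl | ⟨q, v, rfl⟩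
    · rw [one_mul] at hx hy
      exact ih2 (by omega) hx hy
    · rw [mk_of_mul] at he1
      have := congrArg len he1
      simp at this; omega
    · rw [mk_of_mul] at he1
      have := congrArg len he1
      simp at this
    · rw [mul_assoc] at hx hy
      obtain ⟨rfl, rfl⟩ := of_mul_inj hx
      obtain ⟨rfl, rfl⟩ := of_mul_inj hy
      obtain ⟨z, h1, h2⟩ := ih1 (by omega) rfl rfl
      refine ⟨z * PresentedMonoid.mk _ c, ?_, ?_⟩
      · rw [map_mul, h1, mul_assoc]
      · rw [map_mul, h2, he2, mul_assoc]

theorem lcmUpTo (hs : ∀ i j, adj i j → adj j i)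
    (ht : ∀ i j k, adj k i → adj k j → ¬ adj i j) (hi : ∀ i, ¬ adj i i) (m : ℕ) :
    LcmUpTo adj m := by
  induction m with
  | zero =>
    intro i j x y hl
    simp at hl
  | succ m ih =>
    intro i j x y hl h
    obtain ⟨x, rfl⟩ := PresentedMonoid.surjective_mk x
    obtain ⟨y, rfl⟩ := PresentedMonoid.surjective_mk y
    rw [← mk_of_mul] at hl h
    rw [← mk_of_mul] at h
    exact lcm_of_conGen hs ht hi ih (PresentedMonoid.mk_eq_mk_iff.1 h) hl rfl rfl

theorem exists_compl (hs : ∀ i j, adj i j → adj j i)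
    (ht : ∀ i j k, adj k i → adj k j → ¬ adj i j) (hi : ∀ i, ¬ adj i i)
    {i j : ι} {x y : Artin adj} (h : gen adj i * x = gen adj j * y) :
    ∃ z, x = compl adj i j * z ∧ y = compl adj j i * z :=
  lcmUpTo hs ht hi _ i j x y le_rfl h

@[elab_as_elim]
theorem gen_induction {p : Artin adj → Prop} (one : p 1)
    (mul : ∀ i x, p x → p (gen adj i * x)) (x : Artin adj) : p x := by
  obtain ⟨x, rfl⟩ := PresentedMonoid.surjective_mk x
  induction x using FreeMonoid.recOn with
  | one => exact one
  | of_mul i x ih => exact mk_of_mul (adj := adj) i x ▸ mul i _ ih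

theorem mul_left_cancel (hs : ∀ i j, adj i j → adj j i)
    (ht : ∀ i j k, adj k i → adj k j → ¬ adj i j) (hi : ∀ i, ¬ adj i i)
    (u : Artin adj) {x y : Artin adj} (h : u * x = u * y) : x = y := by
  induction u using gen_induction with
  | one => simpa using h
  | mul i u ih =>
    rw [mul_assoc, mul_assoc] at h
    exact ih ((lcmUpTo hs ht hi _).cancel le_rfl h)

end ArtinMonoid

/-! ### Embedding a left cancellative monoid with a central Garside element into a group -/

theorem exists_injective_hom_group.{u} {B : Type u} [Monoid B]
    (hc : ∀ u x y : B, u * x = u * y → x = y) (δ : B) (hδ : ∀ x, δ * x = x * δ)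
    (hd : ∀ x : B, ∃ t : B, ∃ k : ℕ, t * x = δ ^ k) :
    ∃ (H : Type u) (_ : Group H) (f : B →* H), Function.Injective f := by
  have hδ' : ∀ (k : ℕ) (x : B), δ ^ k * x = x * δ ^ k := fun k x =>
    ((show Commute δ x from hδ x).pow_left k).eq
  choose t k ht using hd
  have ht' : ∀ x, x * t x = δ ^ k x := fun x => hc (t x) _ _ (by
    rw [← mul_assoc, ht, hδ'])
  let _ : OreLocalization.OreSet (⊤ : Submonoid B) :=
    { ore_right_cancel := fun r₁ r₂ s h => ⟨1, by
        have h2 := congrArg (· * t s) h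
        simp only [mul_assoc, ht', ← hδ'] at h2
        rw [hc _ _ _ h2]⟩
      oreNum := fun r s => r * t s
      oreDenom := fun r s => ⟨δ ^ k s, trivial⟩
      ore_eq := fun r s => by
        rw [mul_assoc, ht, hδ'] }
  let f : B →* (OreLocalization (⊤ : Submonoid B) B)ˣ :=
    { toFun := fun b => OreLocalization.numeratorUnit ⟨b, trivial⟩
      map_one' := Units.ext (map_one OreLocalization.numeratorHom)
      map_mul' := fun x y => Units.ext (map_mul OreLocalization.numeratorHom x y) }
  refine ⟨_, inferInstance, f, fun x y h => ?_⟩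
  have h2 : OreLocalization.oreDiv x (1 : (⊤ : Submonoid B)) = OreLocalization.oreDiv y 1 :=
    congrArg Units.val h
  obtain ⟨u, v, h3, h4⟩ := OreLocalization.oreDiv_eq_iff.1 h2
  have h5 : (u : B) = v := by simpa using h4
  have h6 : (u : B) * y = v * x := h3
  rw [h5] at h6
  exact (hc _ _ _ h6).symm

/-! ### The Coxeter element of a sequence satisfying the braid relations -/

section CoxeterElement

variable {B : Type*} [Monoid B]

/-- The product `s 0 * s 1 * ⋯ * s (k - 1)`. -/
def initialProd (s : ℕ → B) : ℕ → B
  | 0 => 1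
  | k + 1 => initialProd s k * s k

/-- The braid relations between the first `n` terms of a sequence. -/
structure BraidRelations (s : ℕ → B) (n : ℕ) : Prop where
  braid : ∀ i, i + 1 < n → s i * s (i + 1) * s i = s (i + 1) * s i * s (i + 1)
  comm : ∀ i j, i + 2 ≤ j → j < n → s i * s j = s j * s i

namespace BraidRelations

variable {s : ℕ → B} {n : ℕ}

theorem initialProd_mul_of_lt (h : BraidRelations s n) {k j : ℕ} (hkj : k < j) (hj : j < n) :
    initialProd s k * s j = s j * initialProd s k := by
  induction k with
  | zero => simp [initialProd]
  | succ k ih =>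
    rw [initialProd, mul_assoc, h.comm k j (by omega) hj, ← mul_assoc, ih (by omega), mul_assoc]

theorem initialProd_mul (h : BraidRelations s n) {k i : ℕ} (hik : i + 1 < k) (hk : k ≤ n) :
    initialProd s k * s i = s (i + 1) * initialProd s k := by
  induction k with
  | zero => omega
  | succ k ih =>
    rcases Nat.lt_or_ge (i + 1) k with hlt | hge
    · rw [initialProd, mul_assoc, ← h.comm i k (by omega) (by omega), ← mul_assoc,
        ih hlt (by omega), mul_assoc]
    · obtain rfl : k = i + 1 := by omega
      rw [initialProd, initialProd, mul_assoc, mul_assoc, ← mul_assoc (s i), h.braid i (by omega),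
        ← mul_assoc, ← mul_assoc, h.initialProd_mul_of_lt (by omega) (by omega)]
      simp only [mul_assoc]

theorem mul_initialProd_mul (h : BraidRelations s n) {k : ℕ} (hk : k + 1 ≤ n) :
    s 0 * (initialProd s n * initialProd s k) = initialProd s (k + 1) * initialProd s n := by
  induction k with
  | zero => simp [initialProd]
  | succ k ih =>
    rw [initialProd, ← mul_assoc, ← mul_assoc, mul_assoc (s 0), ih (by omega), mul_assoc,
      h.initialProd_mul (by omega) le_rfl, ← mul_assoc]
    rfl

theorem initialProd_pow_mul (h : BraidRelations s n) {i m : ℕ} (him : i + m < n) :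
    initialProd s n ^ m * s i = s (i + m) * initialProd s n ^ m := by
  induction m with
  | zero => simp
  | succ m ih =>
    rw [pow_succ', mul_assoc, ih (by omega), ← mul_assoc, h.initialProd_mul (by omega) le_rfl,
      mul_assoc, add_assoc]

theorem initialProd_sq_mul_last (h : BraidRelations s (n + 1)) :
    initialProd s (n + 1) ^ 2 * s n = s 0 * initialProd s (n + 1) ^ 2 := by
  have h1 := congrArg (· * s n) (h.mul_initialProd_mul (k := n) le_rfl)
  simp only [mul_assoc] at h1
  rw [pow_two, mul_assoc, ← h1]
  rfl

theorem initialProd_pow_central (h : BraidRelations s n) {i : ℕ} (hi : i < n) :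
    initialProd s n ^ (n + 1) * s i = s i * initialProd s n ^ (n + 1) := by
  obtain ⟨m, rfl⟩ : ∃ m, n = i + m + 1 := ⟨n - 1 - i, by omega⟩
  have h0 := h.initialProd_pow_mul (i := 0) (m := i) (by omega)
  rw [zero_add] at h0
  rw [show i + m + 1 + 1 = i + 2 + m by omega, pow_add, pow_add, mul_assoc,
    h.initialProd_pow_mul (by omega), mul_assoc, ← mul_assoc (_ ^ 2), h.initialProd_sq_mul_last,
    ← mul_assoc, ← mul_assoc, h0, mul_assoc, mul_assoc, mul_assoc]

theorem exists_mul_eq_pow (h : BraidRelations s n) {i : ℕ} (hi : i < n) :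
    ∃ t, t * s i = initialProd s n ^ (n + 1) := by
  obtain ⟨m, rfl⟩ : ∃ m, n = i + m + 1 := ⟨n - 1 - i, by omega⟩
  refine ⟨initialProd s (i + m + 1) ^ (i + 1) *
    (initialProd s (i + m) * initialProd s (i + m + 1) ^ m), ?_⟩
  rw [mul_assoc, mul_assoc, h.initialProd_pow_mul (by omega), ← mul_assoc (initialProd s (i + m)),
    show initialProd s (i + m) * s (i + m) = initialProd s (i + m + 1) from rfl, ← pow_succ',
    ← pow_add]
  congr 1
  omega

end BraidRelations

end CoxeterElement

/-! ### The positive braid monoid embeds in the braid group -/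

namespace PositiveBraid

open BraidOrder

/-- Adjacency in the Coxeter graph of type `A`. -/
def adj (n : ℕ) (i j : Fin n) : Prop := (i : ℕ) + 1 = j ∨ (j : ℕ) + 1 = i

/-- The abstract monoid of positive braids. -/
abbrev BM (n : ℕ) := ArtinMonoid.Artin (adj n)

theorem adj_symm (n : ℕ) : ∀ i j, adj n i j → adj n j i := fun _ _ h => h.symm

theorem adj_triangle_free (n : ℕ) : ∀ i j k, adj n k i → adj n k j → ¬ adj n i j := by
  intro i j k
  unfold adj
  omega

theorem adj_irrefl (n : ℕ) : ∀ i, ¬ adj n i i := by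
  intro i
  unfold adj
  omega

/-- The generators of the positive braid monoid, extended by `1`. -/
def sgen (n i : ℕ) : BM n := if h : i < n then ArtinMonoid.gen (adj n) ⟨i, h⟩ else 1

theorem sgen_of_lt {n i : ℕ} (h : i < n) : sgen n i = ArtinMonoid.gen (adj n) ⟨i, h⟩ := by
  simp [sgen, h]

theorem sgen_braidRelations (n : ℕ) : BraidRelations (sgen n) n where
  braid i h := by
    rw [sgen_of_lt h, sgen_of_lt (show i < n by omega)]
    have := ArtinMonoid.gen_braid (adj := adj n) (i := ⟨i, by omega⟩) (j := ⟨i + 1, h⟩)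
      (Or.inl rfl) 1
    simpa [mul_assoc] using this
  comm i j hij h := by
    rw [sgen_of_lt h, sgen_of_lt (show i < n by omega)]
    have := ArtinMonoid.gen_comm (adj := adj n) (i := ⟨i, by omega⟩) (j := ⟨j, h⟩)
      (by simp only [adj]; omega) 1
    simpa using this

theorem exists_embedding (n : ℕ) :
    ∃ (H : Type) (_ : Group H) (f : BM n →* H), Function.Injective f := by
  have hr := sgen_braidRelations n
  have hcen : ∀ x : BM n, initialProd (sgen n) n ^ (n + 1) * x =
      x * initialProd (sgen n) n ^ (n + 1) := by
    intro x
    induction x using ArtinMonoid.gen_induction with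
    | one => simp
    | mul i x ih =>
      rw [← sgen_of_lt i.2, ← mul_assoc, hr.initialProd_pow_central i.2, mul_assoc, ih, mul_assoc]
  refine exists_injective_hom_group
    (fun u x y h => ArtinMonoid.mul_left_cancel (adj_symm n) (adj_triangle_free n)
      (adj_irrefl n) u h) _ hcen fun x => ?_
  induction x using ArtinMonoid.gen_induction with
  | one => exact ⟨1, 0, by simp⟩
  | mul i x ih =>
    obtain ⟨t, k, h⟩ := ih
    obtain ⟨u, hu⟩ := hr.exists_mul_eq_pow i.2
    refine ⟨t * u, k + 1, ?_⟩
    rw [← sgen_of_lt i.2, mul_assoc, ← mul_assoc u, hu, hcen, ← mul_assoc, h, ← pow_succ]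

theorem gen_of_lt {n i : ℕ} (h : i < n) : BraidOrder.gen n i = PresentedGroup.of ⟨i, h⟩ := by
  simp [BraidOrder.gen, h]

/-- A homomorphism out of the braid group, given by a sequence satisfying the braid relations. -/
def homOfBraidRelations {K : Type*} [Group K] {n : ℕ} {s : ℕ → K} (h : BraidRelations s n) :
    Braid n →* K :=
  PresentedGroup.toGroup (f := fun i : Fin n => s i) (by
    rintro r ⟨i, j, ⟨hij, rfl⟩ | ⟨hij, rfl⟩⟩
    · simp only [map_mul, map_inv, FreeGroup.lift_apply_of, mul_inv_eq_one, ← hij]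
      exact h.braid i (by omega)
    · simp only [map_mul, map_inv, FreeGroup.lift_apply_of, mul_inv_eq_one]
      exact h.comm i j hij j.2)

theorem homOfBraidRelations_gen {K : Type*} [Group K] {n : ℕ} {s : ℕ → K}
    (h : BraidRelations s n) {i : ℕ} (hi : i < n) :
    homOfBraidRelations h (BraidOrder.gen n i) = s i := by
  rw [gen_of_lt hi]
  exact PresentedGroup.toGroup.of _

theorem gen_braidRelations (n : ℕ) : BraidRelations (BraidOrder.gen n) n where
  braid i h := by
    rw [gen_of_lt h, gen_of_lt (show i < n by omega), ← mul_inv_eq_one]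
    exact PresentedGroup.one_of_mem ⟨⟨i, by omega⟩, ⟨i + 1, h⟩, Or.inl ⟨rfl, rfl⟩⟩
  comm i j hij h := by
    rw [gen_of_lt h, gen_of_lt (show i < n by omega), ← mul_inv_eq_one]
    exact PresentedGroup.one_of_mem ⟨⟨i, by omega⟩, ⟨j, h⟩, Or.inr ⟨hij, rfl⟩⟩

/-- A homomorphism out of the positive braid monoid. -/
def liftBM {K : Type*} [Monoid K] {n : ℕ} {s : ℕ → K} (h : BraidRelations s n) : BM n →* K :=
  PresentedMonoid.lift (fun i : Fin n => s i) (by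
    rintro a b (⟨hij | hij⟩ | @⟨i, j, hij⟩)
    · simp only [map_mul, FreeMonoid.lift_eval_of, ← mul_assoc, ← hij]
      exact h.braid _ (by omega)
    · simp only [map_mul, FreeMonoid.lift_eval_of, ← mul_assoc, ← hij]
      exact (h.braid _ (by omega)).symm
    · simp only [map_mul, FreeMonoid.lift_eval_of]
      unfold adj at hij
      rcases lt_trichotomy (i : ℕ) j with hlt | heq | hgt
      · exact h.comm _ _ (by omega) j.2
      · rw [heq]
      · exact (h.comm _ _ (by omega) i.2).symm)

theorem liftBM_gen {K : Type*} [Monoid K] {n : ℕ} {s : ℕ → K} (h : BraidRelations s n)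
    (i : Fin n) : liftBM h (ArtinMonoid.gen (adj n) i) = s i :=
  PresentedMonoid.lift_of _ _

/-- The natural map from the positive braid monoid to the braid group. -/
def toBraid (n : ℕ) : BM n →* Braid n := liftBM (gen_braidRelations n)

theorem toBraid_gen {n : ℕ} (i : Fin n) :
    toBraid n (ArtinMonoid.gen (adj n) i) = BraidOrder.gen n i := liftBM_gen _ i

theorem toBraid_injective (n : ℕ) : Function.Injective (toBraid n) := by
  obtain ⟨H, _, f, hf⟩ := exists_embedding n
  have hr : BraidRelations (fun i => f (sgen n i)) n :=
    ⟨fun i h => by simp only [← map_mul, (sgen_braidRelations n).braid i h],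
      fun i j hij h => by simp only [← map_mul, (sgen_braidRelations n).comm i j hij h]⟩
  have key : ∀ x, homOfBraidRelations hr (toBraid n x) = f x := by
    intro x
    induction x using ArtinMonoid.gen_induction with
    | one => simp
    | mul i x ih =>
      rw [map_mul, map_mul, map_mul, ih, toBraid_gen, homOfBraidRelations_gen hr i.2,
        sgen_of_lt i.2]
  intro x y h
  exact hf (by rw [← key, ← key, h])

theorem mem_Mb_iff {n : ℕ} {x : Braid n} : x ∈ Mb n ↔ ∃ y, toBraid n y = x := by
  constructor
  · intro h
    induction h using Submonoid.closure_induction with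
    | mem x hx =>
      obtain ⟨i, hi, rfl⟩ := hx
      exact ⟨_, toBraid_gen ⟨i, hi⟩⟩
    | one => exact ⟨1, map_one _⟩
    | mul x y _ _ hx hy =>
      obtain ⟨x, rfl⟩ := hx
      obtain ⟨y, rfl⟩ := hy
      exact ⟨x * y, map_mul _ _ _⟩
  · rintro ⟨y, rfl⟩
    induction y using ArtinMonoid.gen_induction with
    | one => rw [map_one]; exact one_mem _
    | mul i y ih =>
      rw [map_mul, toBraid_gen]
      exact mul_mem (Submonoid.subset_closure ⟨i, i.2, rfl⟩) ih

end PositiveBraid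

/-! ### Parabolic submonoids -/

section Parabolic

variable {G : Type*} [Group G]

/-- The submonoid generated by the elements `g i` with `i < n` and `J i`. -/
def par (g : ℕ → G) (n : ℕ) (J : ℕ → Prop) : Submonoid G :=
  Submonoid.closure {x | ∃ i, i < n ∧ J i ∧ x = g i}

/-- The submonoid generated by the elements `g i` with `i < n`. -/
def pos (g : ℕ → G) (n : ℕ) : Submonoid G := par g n fun _ => True

theorem gen_mem_par {g : ℕ → G} {n : ℕ} {J : ℕ → Prop} {i : ℕ} (hi : i < n) (hJ : J i) :
    g i ∈ par g n J := Submonoid.subset_closure ⟨i, hi, hJ, rfl⟩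

theorem gen_mem_pos {g : ℕ → G} {n i : ℕ} (hi : i < n) : g i ∈ pos g n :=
  gen_mem_par hi trivial

theorem par_mono {g : ℕ → G} {n : ℕ} {J K : ℕ → Prop} (h : ∀ i, i < n → J i → K i) :
    par g n J ≤ par g n K :=
  Submonoid.closure_mono fun _ ⟨i, hi, hJ, hx⟩ => ⟨i, hi, h i hi hJ, hx⟩

theorem par_le_pos {g : ℕ → G} {n : ℕ} {J : ℕ → Prop} : par g n J ≤ pos g n :=
  par_mono fun _ _ _ => trivial

/-- The properties of the standard generators `g 0, …, g (n - 1)` of a braid group. -/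
structure IsBraidSystem (g : ℕ → G) (n : ℕ) : Prop extends BraidRelations g n where
  lcm_comm : ∀ i j, i + 2 ≤ j → j < n → ∀ z ∈ pos g n, ∀ w ∈ pos g n, z * g i = w * g j →
    ∃ v ∈ pos g n, z = v * g j ∧ w = v * g i
  lcm_braid : ∀ i, i + 1 < n → ∀ z ∈ pos g n, ∀ w ∈ pos g n, z * g i = w * g (i + 1) →
    ∃ v ∈ pos g n, z = v * g i * g (i + 1) ∧ w = v * g (i + 1) * g i
  of_mul_mem : ∀ J : ℕ → Prop, ∀ a ∈ pos g n, ∀ b ∈ pos g n, a * b ∈ par g n J →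
    a ∈ par g n J ∧ b ∈ par g n J
  of_gen_mem : ∀ (J : ℕ → Prop) (i : ℕ), i < n → g i ∈ par g n J → J i
  exists_len : ∃ f : G →* Multiplicative ℤ, ∀ i, i < n → f (g i) = Multiplicative.ofAdd 1
  exists_rev : ∃ f : G →* Gᵐᵒᵖ, ∀ i, i < n → f (g i) = MulOpposite.op (g i)

end Parabolic

namespace PositiveBraid

open BraidOrder

theorem pos_gen (n : ℕ) : pos (BraidOrder.gen n) n = Mb n := by
  simp [pos, par, Mb]

/-- The homomorphism from positive braids to `{0, 1}` detecting membership in a parabolic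
submonoid. -/
def suppHom (n : ℕ) (J : ℕ → Prop) [DecidablePred J] : BM n →* ℕ :=
  liftBM (s := fun i => if J i then 1 else 0)
    ⟨fun i _ => by by_cases h1 : J i <;> by_cases h2 : J (i + 1) <;> simp [h1, h2],
      fun i j _ _ => mul_comm _ _⟩

theorem toBraid_mem_par_iff {n : ℕ} (J : ℕ → Prop) [DecidablePred J] (x : BM n) :
    toBraid n x ∈ par (BraidOrder.gen n) n J ↔ suppHom n J x = 1 := by
  constructor
  · intro h
    have : ∀ y ∈ par (BraidOrder.gen n) n J, ∃ x, toBraid n x = y ∧ suppHom n J x = 1 := by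
      intro y hy
      induction hy using Submonoid.closure_induction with
      | mem y hy =>
        obtain ⟨i, hi, hJ, rfl⟩ := hy
        exact ⟨_, toBraid_gen ⟨i, hi⟩, (liftBM_gen _ _).trans (if_pos hJ)⟩
      | one => exact ⟨1, map_one _, map_one _⟩
      | mul y z _ _ hy hz =>
        obtain ⟨y, rfl, hy⟩ := hy
        obtain ⟨z, rfl, hz⟩ := hz
        exact ⟨y * z, map_mul _ _ _, by rw [map_mul, hy, hz]⟩
    obtain ⟨y, hy, h1⟩ := this _ h
    rwa [← toBraid_injective n hy]
  · intro h
    induction x using ArtinMonoid.gen_induction with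
    | one => rw [map_one]; exact one_mem _
    | mul i x ih =>
      rw [map_mul, mul_eq_one] at h
      rw [map_mul, toBraid_gen]
      refine mul_mem (gen_mem_par i.2 ?_) (ih h.2)
      by_contra hJ
      have := h.1
      rw [suppHom, liftBM_gen, if_neg hJ] at this
      exact zero_ne_one this

/-- The anti-automorphism of the braid group fixing the generators. -/
def rev (n : ℕ) : Braid n →* (Braid n)ᵐᵒᵖ :=
  homOfBraidRelations (s := fun i => MulOpposite.op (BraidOrder.gen n i))
    ⟨fun i h => by
      simp only [← MulOpposite.op_mul, ← mul_assoc, (gen_braidRelations n).braid i h],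
    fun i j hij h => by
      simp only [← MulOpposite.op_mul, (gen_braidRelations n).comm i j hij h]⟩

theorem rev_gen {n i : ℕ} (h : i < n) :
    rev n (BraidOrder.gen n i) = MulOpposite.op (BraidOrder.gen n i) :=
  homOfBraidRelations_gen _ h

theorem unop_rev_mem {n : ℕ} {x : Braid n} (hx : x ∈ Mb n) : (rev n x).unop ∈ Mb n := by
  induction hx using Submonoid.closure_induction with
  | mem x hx =>
    obtain ⟨i, hi, rfl⟩ := hx
    rw [rev_gen hi]
    exact Submonoid.subset_closure ⟨i, hi, rfl⟩
  | one => rw [map_one]; exact one_mem _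
  | mul x y _ _ hx hy => rw [map_mul, MulOpposite.unop_mul]; exact mul_mem hy hx

theorem unop_rev_unop_rev {n : ℕ} {x : Braid n} (hx : x ∈ Mb n) :
    (rev n (rev n x).unop).unop = x := by
  induction hx using Submonoid.closure_induction with
  | mem x hx =>
    obtain ⟨i, hi, rfl⟩ := hx
    rw [rev_gen hi, MulOpposite.unop_op, rev_gen hi, MulOpposite.unop_op]
  | one => simp
  | mul x y _ _ hx hy => simp [hx, hy]

theorem exists_eq_mul_compl {n : ℕ} {i j : Fin n} {z w : Braid n} (hz : z ∈ Mb n) (hw : w ∈ Mb n)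
    (h : z * BraidOrder.gen n i = w * BraidOrder.gen n j) :
    ∃ v ∈ Mb n, z = v * (rev n (toBraid n (ArtinMonoid.compl (adj n) i j))).unop ∧
      w = v * (rev n (toBraid n (ArtinMonoid.compl (adj n) j i))).unop := by
  have h1 := congrArg (fun x => (rev n x).unop) h
  simp only [map_mul, MulOpposite.unop_mul, rev_gen i.2, rev_gen j.2, MulOpposite.unop_op] at h1
  obtain ⟨z', hz'⟩ := mem_Mb_iff.1 (unop_rev_mem hz)
  obtain ⟨w', hw'⟩ := mem_Mb_iff.1 (unop_rev_mem hw)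
  rw [← hz', ← hw', ← toBraid_gen, ← toBraid_gen, ← map_mul, ← map_mul] at h1
  obtain ⟨v, rfl, rfl⟩ := ArtinMonoid.exists_compl (adj_symm n) (adj_triangle_free n)
    (adj_irrefl n) (toBraid_injective n h1)
  refine ⟨_, unop_rev_mem (mem_Mb_iff.2 ⟨v, rfl⟩), ?_, ?_⟩
  · rw [← unop_rev_unop_rev hz, ← hz']
    simp
  · rw [← unop_rev_unop_rev hw, ← hw']
    simp

theorem isBraidSystem (n : ℕ) : IsBraidSystem (BraidOrder.gen n) n where
  toBraidRelations := gen_braidRelations n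
  lcm_comm i j hij hj z hz w hw h := by
    rw [pos_gen] at hz hw ⊢
    obtain ⟨v, hv, h1, h2⟩ := exists_eq_mul_compl (i := ⟨i, by omega⟩) (j := ⟨j, hj⟩) hz hw h
    have hne : (⟨i, by omega⟩ : Fin n) ≠ ⟨j, hj⟩ := by simp; omega
    rw [ArtinMonoid.compl_of_not_adj hne (by simp only [adj]; omega), toBraid_gen, rev_gen hj] at h1
    rw [ArtinMonoid.compl_of_not_adj hne.symm (by simp only [adj]; omega), toBraid_gen,
      rev_gen (by simp; omega)] at h2
    exact ⟨v, hv, h1, h2⟩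
  lcm_braid i hi z hz w hw h := by
    rw [pos_gen] at hz hw ⊢
    obtain ⟨v, hv, h1, h2⟩ := exists_eq_mul_compl (i := ⟨i, by omega⟩) (j := ⟨i + 1, hi⟩) hz hw h
    have hne : (⟨i, by omega⟩ : Fin n) ≠ ⟨i + 1, hi⟩ := by simp
    have hi' : i < n := by omega
    rw [ArtinMonoid.compl_of_adj hne (Or.inl rfl), map_mul, toBraid_gen, toBraid_gen, map_mul,
      rev_gen hi, rev_gen hi'] at h1
    rw [ArtinMonoid.compl_of_adj hne.symm (Or.inr rfl), map_mul, toBraid_gen, toBraid_gen, map_mul,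
      rev_gen hi, rev_gen hi'] at h2
    exact ⟨v, hv, by simpa [mul_assoc] using h1, by simpa [mul_assoc] using h2⟩
  of_mul_mem J a ha b hb h := by
    classical
    rw [pos_gen] at ha hb
    obtain ⟨a, rfl⟩ := mem_Mb_iff.1 ha
    obtain ⟨b, rfl⟩ := mem_Mb_iff.1 hb
    rw [← map_mul, toBraid_mem_par_iff, map_mul, mul_eq_one] at h
    rwa [toBraid_mem_par_iff, toBraid_mem_par_iff]
  of_gen_mem J i hi h := by
    classical
    by_contra hJ
    rw [show i = (⟨i, hi⟩ : Fin n) from rfl, ← toBraid_gen, toBraid_mem_par_iff, suppHom,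
      liftBM_gen, if_neg hJ] at h
    exact zero_ne_one h
  exists_len := ⟨homOfBraidRelations (s := fun _ => Multiplicative.ofAdd 1)
    ⟨fun _ _ => rfl, fun _ _ _ _ => rfl⟩, fun _ h => homOfBraidRelations_gen _ h⟩
  exists_rev := ⟨rev n, fun _ h => rev_gen h⟩

end PositiveBraid

/-! ### Divisibility in a braid system -/

namespace IsBraidSystem

variable {G : Type*} [Group G] {g : ℕ → G} {n : ℕ}

theorem exists_natLen (h : IsBraidSystem g n) : ∃ ℓ : G → ℕ,
    (∀ x ∈ pos g n, ∀ y ∈ pos g n, ℓ (x * y) = ℓ x + ℓ y) ∧ ∀ i, i < n → ℓ (g i) = 1 := by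
  obtain ⟨f, hf⟩ := h.exists_len
  have hpos : ∀ x ∈ pos g n, 0 ≤ (f x).toAdd := by
    intro x hx
    induction hx using Submonoid.closure_induction with
    | mem x hx =>
      obtain ⟨i, hi, _, rfl⟩ := hx
      simp [hf i hi]
    | one => simp
    | mul x y _ _ hx hy =>
      rw [map_mul, toAdd_mul]
      exact add_nonneg hx hy
  refine ⟨fun x => (f x).toAdd.toNat, fun x hx y hy => ?_, fun i hi => by simp [hf i hi]⟩
  simp only [map_mul, toAdd_mul]
  exact Int.toNat_add (hpos x hx) (hpos y hy)

theorem eq_one_or_eq_mul_gen {J : ℕ → Prop} {x : G} (hx : x ∈ par g n J) :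
    x = 1 ∨ ∃ y ∈ par g n J, ∃ i, i < n ∧ J i ∧ x = y * g i := by
  induction hx using Submonoid.closure_induction_right with
  | one => exact Or.inl rfl
  | mul_right x hx y hy _ =>
    obtain ⟨i, hi, hJ, rfl⟩ := hy
    exact Or.inr ⟨x, hx, i, hi, hJ, rfl⟩

theorem eq_one_of_mul_eq_one (h : IsBraidSystem g n) {x y : G} (hx : x ∈ pos g n)
    (hy : y ∈ pos g n) (hxy : x * y = 1) : x = 1 := by
  have h1 := (h.of_mul_mem (fun _ => False) x hx y hy (hxy ▸ one_mem _)).1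
  rcases eq_one_or_eq_mul_gen h1 with h2 | ⟨_, _, _, _, h2, _⟩
  · exact h2
  · exact h2.elim

theorem comm_far (h : IsBraidSystem g n) {i j : ℕ} (hi : i < n) (hj : j < n)
    (hij : i + 2 ≤ j ∨ j + 2 ≤ i) : g i * g j = g j * g i := by
  rcases hij with hij | hij
  · exact h.comm i j hij hj
  · exact (h.comm j i hij hi).symm

theorem braid_adj (h : IsBraidSystem g n) {i j : ℕ} (hi : i < n) (hj : j < n)
    (hij : i + 1 = j ∨ j + 1 = i) : g i * g j * g i = g j * g i * g j := by
  rcases hij with rfl | rfl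
  · exact h.braid i hj
  · exact (h.braid j hi).symm

theorem lcm_far (h : IsBraidSystem g n) {i j : ℕ} (hi : i < n) (hj : j < n)
    (hij : i + 2 ≤ j ∨ j + 2 ≤ i) {z w : G} (hz : z ∈ pos g n) (hw : w ∈ pos g n)
    (hzw : z * g i = w * g j) : ∃ v ∈ pos g n, z = v * g j ∧ w = v * g i := by
  rcases hij with hij | hij
  · exact h.lcm_comm i j hij hj z hz w hw hzw
  · obtain ⟨v, hv, h1, h2⟩ := h.lcm_comm j i hij hi w hw z hz hzw.symm
    exact ⟨v, hv, h2, h1⟩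

theorem lcm_adj (h : IsBraidSystem g n) {i j : ℕ} (hi : i < n) (hj : j < n)
    (hij : i + 1 = j ∨ j + 1 = i) {z w : G} (hz : z ∈ pos g n) (hw : w ∈ pos g n)
    (hzw : z * g i = w * g j) : ∃ v ∈ pos g n, z = v * g i * g j ∧ w = v * g j * g i := by
  rcases hij with rfl | rfl
  · exact h.lcm_braid i hj z hz w hw hzw
  · obtain ⟨v, hv, h1, h2⟩ := h.lcm_braid j hi w hw z hz hzw.symm
    exact ⟨v, hv, h2, h1⟩

/-- `a` has no right divisor among the generators in `J`. -/
def Reduced (g : ℕ → G) (n : ℕ) (J : ℕ → Prop) (a : G) : Prop :=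
  ∀ j, j < n → J j → ∀ z ∈ pos g n, a ≠ z * g j

theorem Reduced.eq_one {J : ℕ → Prop} {a : G} (hr : Reduced g n J a) (ha : a ∈ par g n J) :
    a = 1 := by
  rcases eq_one_or_eq_mul_gen ha with h | ⟨y, hy, i, hi, hJ, h⟩
  · exact h
  · exact (hr i hi hJ y (par_le_pos hy) h).elim

theorem gen_divides_of_reduced_mul (h : IsBraidSystem g n) {J : ℕ → Prop} {a : G}
    (ha : a ∈ pos g n) (hr : Reduced g n J a) {b : G} (hb : b ∈ par g n J) {s : ℕ} (hs : s < n)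
    (hJ : J s) {d : G} (hd : d ∈ pos g n) (hab : a * b = d * g s) :
    ∃ d' ∈ pos g n, b = d' * g s := by
  obtain ⟨ℓ, hmul, hgen⟩ := h.exists_natLen
  induction hm : ℓ b using Nat.strong_induction_on generalizing b s d with
  | _ m ih =>
  rcases eq_one_or_eq_mul_gen hb with rfl | ⟨b₁, hb₁, t, ht, hJt, rfl⟩
  · exact (hr s hs hJ d hd (by rw [← hab, mul_one])).elim
  have hb₁' := par_le_pos hb₁
  rw [hmul b₁ hb₁' _ (gen_mem_pos ht), hgen t ht] at hm
  rw [← mul_assoc] at hab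
  by_cases hst : s = t
  · subst hst
    exact ⟨b₁, hb₁', rfl⟩
  by_cases hfar : t + 2 ≤ s ∨ s + 2 ≤ t
  · obtain ⟨v, hv, h1, -⟩ := h.lcm_far ht hs hfar (mul_mem ha hb₁') hd hab
    obtain ⟨d₁, hd₁, rfl⟩ := ih (ℓ b₁) (by omega) hb₁ hs hJ hv h1 rfl
    exact ⟨d₁ * g t, mul_mem hd₁ (gen_mem_pos ht), by
      rw [mul_assoc, mul_assoc, h.comm_far ht hs hfar]⟩
  · have hadj : t + 1 = s ∨ s + 1 = t := by omega
    obtain ⟨v, hv, h1, -⟩ := h.lcm_adj ht hs hadj (mul_mem ha hb₁') hd hab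
    obtain ⟨d₁, hd₁, rfl⟩ := ih (ℓ b₁) (by omega) hb₁ hs hJ (mul_mem hv (gen_mem_pos ht)) h1 rfl
    rw [hmul d₁ hd₁ _ (gen_mem_pos hs)] at hm
    have hd₁' := (h.of_mul_mem J d₁ hd₁ _ (gen_mem_pos hs) hb₁).1
    rw [← mul_assoc] at h1
    obtain ⟨d₂, hd₂, rfl⟩ := ih (ℓ d₁) (by omega) hd₁' ht hJt hv (mul_right_cancel h1) rfl
    refine ⟨d₂ * g s * g t, mul_mem (mul_mem hd₂ (gen_mem_pos hs)) (gen_mem_pos ht), ?_⟩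
    have := h.braid_adj ht hs hadj
    simp only [mul_assoc] at this ⊢
    rw [this]

theorem divides_of_reduced_mul (h : IsBraidSystem g n) {J : ℕ → Prop} {a : G}
    (ha : a ∈ pos g n) (hr : Reduced g n J a) {b : G} (hb : b ∈ par g n J) {c : G}
    (hc : c ∈ par g n J) {d : G} (hd : d ∈ pos g n) (hab : a * b = d * c) :
    ∃ d' ∈ pos g n, b = d' * c ∧ d = a * d' := by
  suffices hs : ∃ d' ∈ pos g n, b = d' * c by
    obtain ⟨d', hd', rfl⟩ := hs
    refine ⟨d', hd', rfl, ?_⟩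
    rw [← mul_assoc] at hab
    exact (mul_right_cancel hab).symm
  induction hc using Submonoid.closure_induction_right generalizing b with
  | one => exact ⟨b, par_le_pos hb, by simp⟩
  | mul_right c hc s hs ih =>
    obtain ⟨s, hs, hJ, rfl⟩ := hs
    rw [← mul_assoc] at hab
    obtain ⟨b₂, hb₂, rfl⟩ := h.gen_divides_of_reduced_mul ha hr hb hs hJ
      (mul_mem hd (par_le_pos hc)) hab
    rw [← mul_assoc] at hab
    obtain ⟨d', hd', rfl⟩ := ih (h.of_mul_mem J _ hb₂ _ (gen_mem_pos hs) hb).1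
      (mul_right_cancel hab)
    exact ⟨d', hd', by rw [mul_assoc]⟩

theorem exists_reduced_mul (h : IsBraidSystem g n) (J : ℕ → Prop) {a : G} (ha : a ∈ pos g n) :
    ∃ a' ∈ pos g n, ∃ b ∈ par g n J, Reduced g n J a' ∧ a = a' * b := by
  obtain ⟨ℓ, hmul, hgen⟩ := h.exists_natLen
  induction hm : ℓ a using Nat.strong_induction_on generalizing a with
  | _ m ih =>
  by_cases hr : Reduced g n J a
  · exact ⟨a, ha, 1, one_mem _, hr, by simp⟩
  unfold Reduced at hr
  push Not at hr
  obtain ⟨j, hj, hJ, z, hz, rfl⟩ := hr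
  rw [hmul z hz _ (gen_mem_pos hj), hgen j hj] at hm
  obtain ⟨a', ha', b, hb, hr, rfl⟩ := ih (ℓ z) (by omega) hz rfl
  exact ⟨a', ha', b * g j, mul_mem hb (gen_mem_par hj hJ), hr, by rw [mul_assoc]⟩

open GarsideOrder in
theorem tail_eq (h : IsBraidSystem g n) {J : ℕ → Prop} {a b : G}
    (ha : a ∈ pos g n) (hr : Reduced g n J a) (hb : b ∈ par g n J) :
    tail (pos g n) (par g n J) (a * b) = b := by
  have hset : {c : G | c ∈ par g n J ∧ leR (pos g n) c (a * b)} =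
      {c : G | c ∈ par g n J ∧ leR (pos g n) c b} := by
    ext c
    simp only [Set.mem_ofPred_eq, and_congr_right_iff, leR]
    intro hc
    constructor
    · intro hd
      obtain ⟨d', hd', rfl, -⟩ := h.divides_of_reduced_mul ha hr hb hc hd (by simp)
      simpa using hd'
    · intro hd
      rw [mul_assoc]
      exact mul_mem ha hd
  have hex : ∃ b' : G, b' ∈ par g n J ∧ {c : G | c ∈ par g n J ∧ leR (pos g n) c (a * b)} =
      {c : G | c ∈ par g n J ∧ leR (pos g n) c b'} := ⟨b, hb, hset⟩
  rw [tail, dif_pos hex]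
  have hspec := hex.choose_spec
  set b' := hex.choose
  rw [hset] at hspec
  have h1 : leR (pos g n) b b' := by
    have : b ∈ {c : G | c ∈ par g n J ∧ leR (pos g n) c b} := ⟨hb, by simp [leR, one_mem]⟩
    rw [hspec.2] at this
    exact this.2
  have h2 : leR (pos g n) b' b := by
    have : b' ∈ {c : G | c ∈ par g n J ∧ leR (pos g n) c b'} :=
      ⟨hspec.1, by simp [leR, one_mem]⟩
    rw [← hspec.2] at this
    exact this.2
  exact mul_inv_eq_one.1 (h.eq_one_of_mul_eq_one h1 h2 (by group))

/-- A set of positive elements that is closed under positive left divisors. -/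
def LeftDivClosed (g : ℕ → G) (n : ℕ) (X : Set G) : Prop :=
  ∀ a ∈ pos g n, ∀ b ∈ pos g n, a * b ∈ X → a ∈ X

theorem leftDivClosed_of_gen {X : Set G}
    (hX : ∀ a ∈ pos g n, ∀ i, i < n → a * g i ∈ X → a ∈ X) : LeftDivClosed g n X := by
  intro a ha b hb hab
  induction hb using Submonoid.closure_induction_right with
  | one => simpa using hab
  | mul_right b hb s hs ih =>
    obtain ⟨i, hi, _, rfl⟩ := hs
    rw [← mul_assoc] at hab
    exact ih (hX _ (mul_mem ha hb) i hi hab)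

/-- The set of products of an element of `X` and an element of the parabolic submonoid of `J`. -/
def mulPar (g : ℕ → G) (n : ℕ) (X : Set G) (J : ℕ → Prop) : Set G :=
  {z | ∃ x ∈ X, ∃ y ∈ par g n J, z = x * y}

theorem mem_of_reduced_mul_mem (h : IsBraidSystem g n) {X : Set G} (hXpos : X ⊆ pos g n)
    (hX : LeftDivClosed g n X) {J : ℕ → Prop} {a b : G} (ha : a ∈ pos g n)
    (hr : Reduced g n J a) (hb : b ∈ par g n J) (hab : a * b ∈ mulPar g n X J) : a ∈ X := by
  obtain ⟨x, hx, m, hm, he⟩ := hab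
  obtain ⟨d, hd, -, rfl⟩ := h.divides_of_reduced_mul ha hr hb hm (hXpos hx) he
  exact hX a ha d hd hx

/-! ### The descending products `g j * ⋯ * g 0` -/

/-- The product `g j * ⋯ * g 1 * g 0`. -/
def descProd (g : ℕ → G) : ℕ → G
  | 0 => g 0
  | j + 1 => g (j + 1) * descProd g j

theorem descProd_mem {j : ℕ} (hj : j < n) : descProd g j ∈ par g n (· ≤ j) := by
  induction j with
  | zero => exact gen_mem_par hj le_rfl
  | succ j ih =>
    exact mul_mem (gen_mem_par hj le_rfl) (par_mono (fun i _ hi => by omega) (ih (by omega)))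

theorem descProd_mem_pos {j : ℕ} (hj : j < n) : descProd g j ∈ pos g n :=
  par_le_pos (descProd_mem hj)

theorem descProd_mul_far (h : IsBraidSystem g n) {i j : ℕ} (hij : j + 1 < i) (hi : i < n) :
    descProd g j * g i = g i * descProd g j := by
  induction j with
  | zero => exact h.comm_far (by omega) hi (by omega)
  | succ j ih =>
    rw [descProd, mul_assoc, ih (by omega), ← mul_assoc, h.comm_far (by omega) hi (by omega),
      mul_assoc]

theorem descProd_mul (h : IsBraidSystem g n) {i j : ℕ} (hij : i + 1 ≤ j) (hj : j < n) :
    descProd g j * g (i + 1) = g i * descProd g j := by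
  induction j with
  | zero => omega
  | succ j ih =>
    rcases Nat.lt_or_ge i j with hlt | hge
    · rw [descProd, mul_assoc, ih (by omega) (by omega), ← mul_assoc,
        h.comm_far (by omega) (by omega) (by omega), mul_assoc]
    · obtain rfl : j = i := by omega
      have hb := h.braid_adj (i := j) (j := j + 1) (by omega) hj (by omega)
      cases j with
      | zero => simpa [descProd, mul_assoc] using hb.symm
      | succ j =>
        rw [descProd, descProd, mul_assoc, mul_assoc,
          h.descProd_mul_far (by omega) (by omega), ← mul_assoc, ← mul_assoc, ← hb]
        simp only [mul_assoc]

/-- Right division of `z * descProd g j` by a generator. -/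
theorem of_mul_descProd_eq (h : IsBraidSystem g n) {j : ℕ} (hj : j < n) {z w : G}
    (hz : z ∈ pos g n) (hw : w ∈ pos g n) {i : ℕ} (hi : i < n)
    (he : z * descProd g j = w * g i) :
    (j + 1 < i → ∃ v ∈ pos g n, z = v * g i) ∧
    (i = j + 1 → ∃ v ∈ pos g n, z = v * g j * g i) ∧
    (∀ k, i = k + 1 → i ≤ j → ∃ v ∈ pos g n, z = v * g k) := by
  induction j generalizing z with
  | zero =>
    refine ⟨fun hij => ?_, fun hij => ?_, fun k hk hij => by omega⟩
    · obtain ⟨v, hv, h1, -⟩ := h.lcm_far hj hi (by omega) hz hw he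
      exact ⟨v, hv, h1⟩
    · obtain ⟨v, hv, h1, -⟩ := h.lcm_adj hj hi (by omega) hz hw he
      exact ⟨v, hv, h1⟩
  | succ j ih =>
    rw [descProd, ← mul_assoc] at he
    obtain ⟨ih1, ih2, ih3⟩ := ih (by omega) (mul_mem hz (gen_mem_pos hj)) he
    refine ⟨fun hij => ?_, fun hij => ?_, fun k hk hij => ?_⟩
    · obtain ⟨z', hz', h1⟩ := ih1 (by omega)
      obtain ⟨v, hv, h2, -⟩ := h.lcm_far hj hi (by omega) hz hz' h1
      exact ⟨v, hv, h2⟩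
    · obtain ⟨z', hz', h1⟩ := ih1 (by omega)
      obtain ⟨v, hv, h2, -⟩ := h.lcm_adj hj hi (by omega) hz hz' h1
      exact ⟨v, hv, h2⟩
    · rcases Nat.lt_or_ge j i with hlt | hge
      · obtain rfl : i = j + 1 := by omega
        obtain rfl : k = j := by omega
        obtain ⟨z', hz', h1⟩ := ih2 rfl
        exact ⟨z', hz', mul_right_cancel h1⟩
      · obtain ⟨z', hz', h1⟩ := ih3 k hk hge
        obtain ⟨v, hv, h2, -⟩ := h.lcm_far hj (by omega) (by omega) hz hz' h1
        exact ⟨v, hv, h2⟩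

theorem gen_mul_par_comm (h : IsBraidSystem g n) {i j : ℕ} (hij : j < i) (hi : i < n) {v : G}
    (hv : v ∈ par g n (· < j)) : g i * v = v * g i := by
  induction hv using Submonoid.closure_induction with
  | mem x hx =>
    obtain ⟨k, hk, hkj, rfl⟩ := hx
    exact h.comm_far hi hk (by omega)
  | one => simp
  | mul x y _ _ hx hy => rw [← mul_assoc, hx, mul_assoc, hy, mul_assoc]

theorem exists_descProd_of_mul_eq (h : IsBraidSystem g n) (hn : 0 < n) {y : G}
    (hy : y ∈ par g n (1 ≤ ·)) {x b : G} (hx : x ∈ pos g n) (hb : b ∈ pos g n)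
    (he : x * y = b * g 0) :
    ∃ j, j < n ∧ ∃ x' ∈ pos g n, ∃ v ∈ par g n (· < j), ∃ w ∈ par g n (1 ≤ ·),
      x = x' * descProd g j ∧ b = x' * v * w := by
  induction hy using Submonoid.closure_induction_left generalizing x with
  | one =>
    exact ⟨0, hn, b, hb, 1, one_mem _, 1, one_mem _, by simpa [descProd] using he, by simp⟩
  | mul_left t ht y hy ih =>
    obtain ⟨i, hi, hi1, rfl⟩ := ht
    rw [← mul_assoc] at he
    obtain ⟨j, hj, x', hx', v, hv, w, hw, h1, rfl⟩ := ih (mul_mem hx (gen_mem_pos hi)) he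
    obtain ⟨c1, c2, c3⟩ := h.of_mul_descProd_eq hj hx' hx hi h1.symm
    rcases lt_trichotomy i (j + 1) with hlt | heq | hgt
    · obtain ⟨k, rfl⟩ : ∃ k, i = k + 1 := ⟨i - 1, by omega⟩
      obtain ⟨z, hz, rfl⟩ := c3 k rfl (by omega)
      rw [mul_assoc z, ← h.descProd_mul (by omega) hj, ← mul_assoc] at h1
      refine ⟨j, hj, z, hz, g k * v, mul_mem (gen_mem_par (by omega) (by omega)) hv, w, hw,
        mul_right_cancel h1, by simp only [mul_assoc]⟩
    · subst heq
      obtain ⟨z, hz, rfl⟩ := c2 rfl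
      rw [mul_assoc z, mul_assoc z, mul_assoc (g j), ← descProd, ← h.descProd_mul le_rfl hi,
        ← mul_assoc] at h1
      refine ⟨j + 1, hi, z, hz, g j * v, mul_mem (gen_mem_par hj (by omega))
        (par_mono (fun k _ hk => by omega) hv), g (j + 1) * w, mul_mem (gen_mem_par hi hi1) hw,
        mul_right_cancel h1, ?_⟩
      have := h.gen_mul_par_comm (Nat.lt_succ_self j) hi hv
      simp only [mul_assoc]
      rw [← mul_assoc (g (j + 1)) v, this, mul_assoc]
    · obtain ⟨z, hz, rfl⟩ := c1 hgt
      rw [mul_assoc z, ← h.descProd_mul_far hgt hi, ← mul_assoc] at h1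
      refine ⟨j, hj, z, hz, v, hv, g i * w, mul_mem (gen_mem_par hi hi1) hw,
        mul_right_cancel h1, ?_⟩
      have := h.gen_mul_par_comm (show j < i by omega) hi hv
      simp only [mul_assoc]
      rw [← mul_assoc (g i) v, this, mul_assoc]

theorem leftDivClosed_mulPar (h : IsBraidSystem g n) (hn : 0 < n) {X : Set G}
    (hXpos : X ⊆ pos g n) (hX : LeftDivClosed g n X)
    (hXN : ∀ x ∈ X, ∀ m ∈ par g n (· + 1 < n), x * m ∈ X) :
    LeftDivClosed g n (mulPar g n X (1 ≤ ·)) := by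
  refine leftDivClosed_of_gen fun a ha s hs => ?_
  rintro ⟨x, hx, y, hy, he⟩
  rcases Nat.eq_zero_or_pos s with rfl | hpos
  · obtain ⟨j, hj, x', hx', v, hv, w, hw, rfl, rfl⟩ :=
      h.exists_descProd_of_mul_eq hn hy (hXpos hx) ha he.symm
    exact ⟨x' * v, hXN _ (hX _ hx' _ (descProd_mem_pos hj) hx) _
      (par_mono (fun i _ hi => by omega) hv), w, hw, rfl⟩
  · obtain ⟨x₀, hx₀, y₀, hy₀, hr, rfl⟩ := h.exists_reduced_mul (1 ≤ ·) (hXpos hx)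
    rw [mul_assoc] at he
    obtain ⟨d, hd, h1, rfl⟩ := h.divides_of_reduced_mul hx₀ hr (mul_mem hy₀ hy)
      (gen_mem_par hs hpos) ha he.symm
    exact ⟨x₀, hX _ hx₀ _ (par_le_pos hy₀) hx, d,
      (h.of_mul_mem _ d hd _ (gen_mem_pos hs) (h1 ▸ mul_mem hy₀ hy)).1, rfl⟩

end IsBraidSystem

/-! ### The flip automorphism and the depth filtration -/

namespace IsBraidSystem

variable {G : Type*} [Group G] {g : ℕ → G} {n : ℕ}

/-- The sequence `g (n - 1), …, g 0`. -/
def flipSeq (g : ℕ → G) (n : ℕ) (i : ℕ) : G := g (n - 1 - i)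

theorem par_flipSeq (J : ℕ → Prop) :
    par (flipSeq g n) n J = par g n fun i => J (n - 1 - i) := by
  apply le_antisymm
  · refine Submonoid.closure_le.2 ?_
    rintro _ ⟨i, hi, hJ, rfl⟩
    refine gen_mem_par (by omega) ?_
    rwa [show n - 1 - (n - 1 - i) = i by omega]
  · refine Submonoid.closure_le.2 ?_
    rintro _ ⟨i, hi, hJ, rfl⟩
    refine Submonoid.subset_closure ⟨n - 1 - i, by omega, hJ, ?_⟩
    rw [flipSeq, show n - 1 - (n - 1 - i) = i by omega]

theorem pos_flipSeq : pos (flipSeq g n) n = pos g n := par_flipSeq _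

theorem par_congr {J K : ℕ → Prop} (h : ∀ i, i < n → (J i ↔ K i)) : par g n J = par g n K :=
  le_antisymm (par_mono fun i hi => (h i hi).1) (par_mono fun i hi => (h i hi).2)

theorem par_flipSeq_one_le : par (flipSeq g n) n (1 ≤ ·) = par g n (· + 1 < n) := by
  rw [par_flipSeq]
  exact par_congr fun i hi => by omega

theorem par_flipSeq_succ_lt : par (flipSeq g n) n (· + 1 < n) = par g n (1 ≤ ·) := by
  rw [par_flipSeq]
  exact par_congr fun i hi => by omega

theorem flip (h : IsBraidSystem g n) : IsBraidSystem (flipSeq g n) n where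
  braid i hi := h.braid_adj (by omega) (by omega) (by omega)
  comm i j hij hj := h.comm_far (by omega) (by omega) (by omega)
  lcm_comm i j hij hj z hz w hw he := by
    rw [pos_flipSeq] at hz hw ⊢
    exact h.lcm_far (by omega) (by omega) (by omega) hz hw he
  lcm_braid i hi z hz w hw he := by
    rw [pos_flipSeq] at hz hw ⊢
    exact h.lcm_adj (by omega) (by omega) (by omega) hz hw he
  of_mul_mem J a ha b hb hab := by
    rw [pos_flipSeq] at ha hb
    rw [par_flipSeq] at hab ⊢
    exact h.of_mul_mem _ a ha b hb hab
  of_gen_mem J i hi hg := by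
    rw [par_flipSeq] at hg
    have := h.of_gen_mem _ (n - 1 - i) (by omega) hg
    rwa [show n - 1 - (n - 1 - i) = i by omega] at this
  exists_len := by
    obtain ⟨f, hf⟩ := h.exists_len
    exact ⟨f, fun i hi => hf _ (by omega)⟩
  exists_rev := by
    obtain ⟨f, hf⟩ := h.exists_rev
    exact ⟨f, fun i hi => hf _ (by omega)⟩

theorem leftDivClosed_mulPar_flip (h : IsBraidSystem g n) (hn : 0 < n) {X : Set G}
    (hXpos : X ⊆ pos g n) (hX : LeftDivClosed g n X)
    (hXM : ∀ x ∈ X, ∀ m ∈ par g n (1 ≤ ·), x * m ∈ X) :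
    LeftDivClosed g n (mulPar g n X (· + 1 < n)) := by
  have := h.flip.leftDivClosed_mulPar (X := X) hn
  simp only [LeftDivClosed, mulPar, pos_flipSeq, par_flipSeq_one_le, par_flipSeq_succ_lt] at this
  exact this hXpos hX hXM

/-- The elements that are products of `2 * d + 1` factors taken alternately in the parabolic
submonoids generated by `g 1, …, g (n - 1)` and by `g 0, …, g (n - 2)`. -/
def depthLE (g : ℕ → G) (n : ℕ) : ℕ → Set G
  | 0 => par g n (1 ≤ ·)
  | d + 1 => mulPar g n (mulPar g n (depthLE g n d) (· + 1 < n)) (1 ≤ ·)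

theorem mulPar_subset_pos {X : Set G} (hX : X ⊆ pos g n) (J : ℕ → Prop) :
    mulPar g n X J ⊆ pos g n := by
  rintro _ ⟨x, hx, y, hy, rfl⟩
  exact mul_mem (hX hx) (par_le_pos hy)

theorem mulPar_mul {X : Set G} {J : ℕ → Prop} : ∀ x ∈ mulPar g n X J, ∀ m ∈ par g n J,
    x * m ∈ mulPar g n X J := by
  rintro _ ⟨x, hx, y, hy, rfl⟩ m hm
  exact ⟨x, hx, y * m, mul_mem hy hm, mul_assoc _ _ _⟩

theorem depthLE_subset_pos (d : ℕ) : depthLE g n d ⊆ pos g n := by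
  induction d with
  | zero => exact par_le_pos
  | succ d ih => exact mulPar_subset_pos (mulPar_subset_pos ih _) _

theorem depthLE_mul (d : ℕ) : ∀ x ∈ depthLE g n d, ∀ m ∈ par g n (1 ≤ ·),
    x * m ∈ depthLE g n d := by
  cases d with
  | zero => exact fun x hx m hm => mul_mem hx hm
  | succ d => exact mulPar_mul

theorem mem_depthLE_succ {d : ℕ} {x y z : G} (hx : x ∈ depthLE g n d)
    (hy : y ∈ par g n (· + 1 < n)) (hz : z ∈ par g n (1 ≤ ·)) :
    x * y * z ∈ depthLE g n (d + 1) := ⟨_, ⟨_, hx, _, hy, rfl⟩, _, hz, rfl⟩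

theorem depthLE_mono {d e : ℕ} (hde : d ≤ e) : depthLE g n d ⊆ depthLE g n e := by
  induction e, hde using Nat.le_induction with
  | base => exact subset_rfl
  | succ e _ ih =>
    intro x hx
    simpa using mem_depthLE_succ (ih hx) (one_mem _) (one_mem _)

theorem leftDivClosed_depthLE (h : IsBraidSystem g n) (hn : 0 < n) (d : ℕ) :
    LeftDivClosed g n (depthLE g n d) := by
  induction d with
  | zero => exact fun a ha b hb hab => (h.of_mul_mem _ a ha b hb hab).1
  | succ d ih =>
    exact h.leftDivClosed_mulPar hn (mulPar_subset_pos (depthLE_subset_pos d) _)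
      (h.leftDivClosed_mulPar_flip hn (depthLE_subset_pos d) ih (depthLE_mul d)) mulPar_mul

theorem exists_mem_depthLE (hn : 2 ≤ n) {a : G} (ha : a ∈ pos g n) :
    ∃ d, a ∈ depthLE g n d := by
  induction ha using Submonoid.closure_induction_right with
  | one => exact ⟨0, one_mem (par g n (1 ≤ ·))⟩
  | mul_right x _ s hs ih =>
    obtain ⟨d, hd⟩ := ih
    obtain ⟨i, hi, -, rfl⟩ := hs
    rcases Nat.eq_zero_or_pos i with rfl | hi0
    · exact ⟨d + 1, by
        simpa using mem_depthLE_succ hd (gen_mem_par hi (show 0 + 1 < n by omega)) (one_mem _)⟩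
    · exact ⟨d, depthLE_mul d _ hd _ (gen_mem_par hi hi0)⟩

theorem mul_mul_mem_depthLE_succ {d : ℕ} {x y z : G} (hx : x ∈ par g n (1 ≤ ·))
    (hy : y ∈ par g n (· + 1 < n)) (hz : z ∈ depthLE g n d) :
    x * y * z ∈ depthLE g n (d + 1) := by
  induction d generalizing z with
  | zero => exact mem_depthLE_succ (d := 0) hx hy hz
  | succ d ih =>
    obtain ⟨_, ⟨a, ha, b, hb, rfl⟩, c, hc, rfl⟩ := hz
    simpa only [mul_assoc] using mem_depthLE_succ (ih ha) hb hc

/-- A reversing anti-automorphism that fixes the generators. -/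
structure IsReversal (g : ℕ → G) (n : ℕ) (r : G → G) : Prop where
  map_mul : ∀ x y, r (x * y) = r y * r x
  map_one : r 1 = 1
  map_gen : ∀ i, i < n → r (g i) = g i

theorem exists_isReversal (h : IsBraidSystem g n) : ∃ r : G → G, IsReversal g n r := by
  obtain ⟨f, hf⟩ := h.exists_rev
  exact ⟨fun x => (f x).unop, fun x y => by simp, by simp, fun i hi => by simp [hf i hi]⟩

namespace IsReversal

variable {r : G → G}

theorem map_par (hr : IsReversal g n r) {J : ℕ → Prop} {x : G} (hx : x ∈ par g n J) :
    r x ∈ par g n J := by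
  induction hx using Submonoid.closure_induction with
  | mem x hx =>
    obtain ⟨i, hi, hJ, rfl⟩ := hx
    rw [hr.map_gen i hi]
    exact gen_mem_par hi hJ
  | one => rw [hr.map_one]; exact one_mem _
  | mul x y _ _ hx hy => rw [hr.map_mul]; exact mul_mem hy hx

theorem involutive (hr : IsReversal g n r) {x : G} (hx : x ∈ pos g n) : r (r x) = x := by
  induction hx using Submonoid.closure_induction with
  | mem x hx =>
    obtain ⟨i, hi, hJ, rfl⟩ := hx
    rw [hr.map_gen i hi, hr.map_gen i hi]
  | one => rw [hr.map_one, hr.map_one]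
  | mul x y _ _ hx hy => rw [hr.map_mul, hr.map_mul, hx, hy]

theorem map_depthLE (hr : IsReversal g n r) {d : ℕ} {x : G} (hx : x ∈ depthLE g n d) :
    r x ∈ depthLE g n d := by
  induction d generalizing x with
  | zero => exact hr.map_par hx
  | succ d ih =>
    obtain ⟨_, ⟨a, ha, b, hb, rfl⟩, c, hc, rfl⟩ := hx
    rw [hr.map_mul, hr.map_mul, ← mul_assoc]
    exact mul_mul_mem_depthLE_succ (hr.map_par hc) (hr.map_par hb) (ih ha)

theorem map_mem_depthLE_iff (hr : IsReversal g n r) {d : ℕ} {x : G} (hx : x ∈ pos g n) :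
    r x ∈ depthLE g n d ↔ x ∈ depthLE g n d :=
  ⟨fun h => by simpa only [hr.involutive hx] using hr.map_depthLE h, hr.map_depthLE⟩

end IsReversal

theorem mul_right_mem_depthLE_iff (h : IsBraidSystem g n) (hn : 0 < n) {d : ℕ} {a b : G}
    (ha : a ∈ par g n (1 ≤ ·)) (hb : b ∈ pos g n) :
    b * a ∈ depthLE g n d ↔ b ∈ depthLE g n d :=
  ⟨h.leftDivClosed_depthLE hn d b hb a (par_le_pos ha), fun hb => depthLE_mul d b hb a ha⟩

theorem mul_left_mem_depthLE_iff (h : IsBraidSystem g n) (hn : 0 < n) {d : ℕ} {a b : G}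
    (ha : a ∈ par g n (1 ≤ ·)) (hb : b ∈ pos g n) :
    a * b ∈ depthLE g n d ↔ b ∈ depthLE g n d := by
  obtain ⟨r, hr⟩ := h.exists_isReversal
  rw [← hr.map_mem_depthLE_iff (mul_mem (par_le_pos ha) hb), hr.map_mul,
    h.mul_right_mem_depthLE_iff hn (hr.map_par ha) (hr.map_par hb), hr.map_mem_depthLE_iff hb]

/-! ### Depth and the filtration -/

open GarsideOrder

/-- The iterated stripping operation attached to a braid system. -/
noncomputable def stripB (g : ℕ → G) (n p : ℕ) (a : G) : G :=
  strip (pos g n) (par g n (1 ≤ ·)) (par g n (· + 1 < n)) p a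

theorem stripB_succ (p : ℕ) (a : G) : stripB g n (p + 1) a = stripB g n p a *
    (tail (pos g n) (if p % 2 = 0 then par g n (1 ≤ ·) else par g n (· + 1 < n))
      (stripB g n p a))⁻¹ := rfl

/-- The depth attached to a braid system. -/
noncomputable def dptB (g : ℕ → G) (n : ℕ) (a : G) : ℕ :=
  dpt (pos g n) (par g n (1 ≤ ·)) (par g n (· + 1 < n)) a

theorem stripB_add_two (i : ℕ) (a : G) :
    stripB g n (i + 2) a = stripB g n i (stripB g n 2 a) := by
  induction i with
  | zero => rfl
  | succ i ih =>
    rw [show i + 1 + 2 = i + 2 + 1 by omega, stripB_succ (i + 2), ih, Nat.add_mod_right,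
      ← stripB_succ i]

theorem strip_one_eq (h : IsBraidSystem g n) {a b : G} (ha : a ∈ pos g n)
    (hr : Reduced g n (1 ≤ ·) a) (hb : b ∈ par g n (1 ≤ ·)) : stripB g n 1 (a * b) = a := by
  simp [stripB, strip, h.tail_eq ha hr hb]

theorem strip_two_eq (h : IsBraidSystem g n) {a b c : G} (ha : a ∈ pos g n)
    (hra : Reduced g n (· + 1 < n) a) (hb : b ∈ par g n (· + 1 < n))
    (hr : Reduced g n (1 ≤ ·) (a * b)) (hc : c ∈ par g n (1 ≤ ·)) :
    stripB g n 2 (a * b * c) = a := by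
  have h1 := h.strip_one_eq (mul_mem ha (par_le_pos hb)) hr hc
  rw [stripB_succ, h1, if_neg (by norm_num), h.tail_eq ha hra hb, mul_inv_cancel_right]

theorem strip_eq_one_iff (h : IsBraidSystem g n) (hn : 0 < n) (d : ℕ) {a : G}
    (ha : a ∈ pos g n) : stripB g n (2 * d + 1) a = 1 ↔ a ∈ depthLE g n d := by
  induction d generalizing a with
  | zero =>
    obtain ⟨a', ha', b, hb, hr, rfl⟩ := h.exists_reduced_mul (1 ≤ ·) ha
    rw [h.strip_one_eq ha' hr hb]
    constructor
    · rintro rfl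
      rwa [one_mul]
    · exact fun hab => hr.eq_one (h.of_mul_mem _ _ ha' _ (par_le_pos hb) hab).1
  | succ d ih =>
    obtain ⟨a₁, ha₁, c, hc, hr₁, rfl⟩ := h.exists_reduced_mul (1 ≤ ·) ha
    obtain ⟨a₂, ha₂, b, hb, hr₂, rfl⟩ := h.exists_reduced_mul (· + 1 < n) ha₁
    rw [show 2 * (d + 1) + 1 = 2 * d + 1 + 2 by ring, stripB_add_two,
      h.strip_two_eq ha₂ hr₂ hb hr₁ hc, ih ha₂]
    constructor
    · exact fun h2 => mem_depthLE_succ h2 hb hc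
    · intro h2
      have h3 := h.mem_of_reduced_mul_mem (mulPar_subset_pos (depthLE_subset_pos d) _)
        (h.leftDivClosed_mulPar_flip hn (depthLE_subset_pos d) (h.leftDivClosed_depthLE hn d)
          (depthLE_mul d)) ha₁ hr₁ hc h2
      exact h.mem_of_reduced_mul_mem (depthLE_subset_pos d) (h.leftDivClosed_depthLE hn d)
        ha₂ hr₂ hb h3

theorem not_one_eq_mul_gen (h : IsBraidSystem g n) {i : ℕ} (hi : i < n) {z : G}
    (hz : z ∈ pos g n) : 1 ≠ z * g i := fun he =>
  (h.of_gen_mem (fun _ => False) i hi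
    (h.of_mul_mem _ z hz _ (gen_mem_pos hi) (he ▸ one_mem _)).2)

theorem tail_one (h : IsBraidSystem g n) (J : ℕ → Prop) : tail (pos g n) (par g n J) 1 = 1 := by
  have := h.tail_eq (J := J) (a := 1) (b := 1) (one_mem _)
    (fun j hj _ z hz => h.not_one_eq_mul_gen hj hz) (one_mem _)
  rwa [one_mul] at this

theorem strip_eq_one_of_le (h : IsBraidSystem g n) {p q : ℕ} (hpq : p ≤ q) {a : G}
    (hp : stripB g n p a = 1) : stripB g n q a = 1 := by
  induction q, hpq using Nat.le_induction with
  | base => exact hp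
  | succ q _ ih =>
    rw [stripB_succ, ih]
    split_ifs <;> simp [h.tail_one]

theorem dpt_le_iff (h : IsBraidSystem g n) (hn : 2 ≤ n) {a : G} (ha : a ∈ pos g n) (d : ℕ) :
    dptB g n a ≤ d ↔ a ∈ depthLE g n d := by
  rw [← h.strip_eq_one_iff (by omega) d ha]
  have hne : {p : ℕ | 1 ≤ p ∧ stripB g n p a = 1}.Nonempty := by
    obtain ⟨e, he⟩ := exists_mem_depthLE hn ha
    exact ⟨2 * e + 1, by omega, (h.strip_eq_one_iff (by omega) e ha).2 he⟩
  have hmem := Nat.sInf_mem hne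
  have hle : dptB g n a ≤ d ↔ sInf {p : ℕ | 1 ≤ p ∧ stripB g n p a = 1} ≤ 2 * d + 1 := by
    change sInf {p : ℕ | 1 ≤ p ∧ stripB g n p a = 1} / 2 ≤ d ↔ _
    omega
  rw [hle]
  exact ⟨fun h1 => h.strip_eq_one_of_le h1 hmem.2, fun h1 => Nat.sInf_le ⟨by omega, h1⟩⟩

/-! ### The element `θ` -/

/-- The element `g 0 * ⋯ * g (n - 1) * g (n - 1) * ⋯ * g 0`. -/
def theta (g : ℕ → G) (n : ℕ) : G := initialProd g n * descProd g (n - 1)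

theorem initialProd_mem {k : ℕ} (hk : k ≤ n) : initialProd g k ∈ par g n (· < k) := by
  induction k with
  | zero => exact one_mem _
  | succ k ih =>
    exact mul_mem (par_mono (fun i _ hi => by omega) (ih (by omega)))
      (gen_mem_par (by omega) (by omega))

theorem initialProd_mul_descProd_flipSeq {j : ℕ} (hj : j < n) :
    initialProd g (n - 1 - j) * descProd (flipSeq g n) j = initialProd g n := by
  induction j with
  | zero =>
    obtain ⟨m, rfl⟩ : ∃ m, n = m + 1 := ⟨n - 1, by omega⟩
    simp [descProd, flipSeq, initialProd]
  | succ j ih =>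
    rw [← ih (by omega), descProd, ← mul_assoc, flipSeq,
      show n - 1 - j = n - 1 - (j + 1) + 1 by omega, initialProd]

theorem descProd_flipSeq (hn : 0 < n) : descProd (flipSeq g n) (n - 1) = initialProd g n := by
  simpa [initialProd] using initialProd_mul_descProd_flipSeq (g := g) (n := n) (j := n - 1) (by omega)

theorem of_mul_initialProd_eq (h : IsBraidSystem g n) {z w : G} (hz : z ∈ pos g n)
    (hw : w ∈ pos g n) {i : ℕ} (hi : i + 1 < n) (he : z * initialProd g n = w * g i) :
    ∃ v ∈ pos g n, z = v * g (i + 1) := by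
  rw [← descProd_flipSeq (by omega)] at he
  have h1 := (h.flip.of_mul_descProd_eq (j := n - 1) (i := n - 1 - i) (by omega)
    (pos_flipSeq (g := g) ▸ hz) (pos_flipSeq (g := g) ▸ hw) (by omega)
    (by rw [he, flipSeq, show n - 1 - (n - 1 - i) = i by omega])).2.2
    (n - 1 - (i + 1)) (by omega) (by omega)
  rw [pos_flipSeq, flipSeq, show n - 1 - (n - 1 - (i + 1)) = i + 1 by omega] at h1
  exact h1

theorem theta_mem (hn : 0 < n) : theta g n ∈ pos g n :=
  mul_mem (par_le_pos (initialProd_mem le_rfl)) (descProd_mem_pos (by omega))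

theorem theta_mul_comm (h : IsBraidSystem g n) {m : G} (hm : m ∈ par g n (1 ≤ ·)) :
    theta g n * m = m * theta g n := by
  induction hm using Submonoid.closure_induction with
  | mem x hx =>
    obtain ⟨i, hi, hi1, rfl⟩ := hx
    obtain ⟨k, rfl⟩ : ∃ k, i = k + 1 := ⟨i - 1, by omega⟩
    rw [theta, mul_assoc, h.descProd_mul (by omega) (by omega), ← mul_assoc,
      h.initialProd_mul hi le_rfl, mul_assoc]
  | one => simp
  | mul x y _ _ hx hy => rw [← mul_assoc, hx, mul_assoc, hy, mul_assoc]

theorem theta_eq (hn : 2 ≤ n) : theta g n =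
    initialProd g (n - 1) * (g (n - 1) * g (n - 1)) * descProd g (n - 2) := by
  obtain ⟨m, rfl⟩ : ∃ m, n = m + 2 := ⟨n - 2, by omega⟩
  simp [theta, initialProd, descProd, mul_assoc]

theorem mul_theta_mem_depthLE (h : IsBraidSystem g n) (hn : 2 ≤ n) {d : ℕ} {b : G}
    (hb : b ∈ depthLE g n (d + 1)) : b * theta g n ∈ depthLE g n (d + 2) := by
  obtain ⟨_, ⟨x, hx, y, hy, rfl⟩, m, hm, rfl⟩ := hb
  have hg : g (n - 1) ∈ par g n (1 ≤ ·) := gen_mem_par (by omega) (show 1 ≤ n - 1 by omega)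
  rw [mul_assoc, ← h.theta_mul_comm hm, theta_eq hn]
  have h1 := mem_depthLE_succ hx
    (mul_mem hy (par_mono (fun i _ hi => by omega) (initialProd_mem (g := g) (n := n)
      (k := n - 1) (by omega)))) (mul_mem hg hg)
  have h2 := mem_depthLE_succ h1 (par_mono (K := (· + 1 < n)) (fun i _ hi => by omega)
    (descProd_mem (g := g) (n := n) (j := n - 2) (by omega))) hm
  simpa only [mul_assoc] using h2

theorem mul_initialProd_mem_of_reduced (h : IsBraidSystem g n) (hn : 2 ≤ n) {d : ℕ} {b : G}
    (hb : b ∈ pos g n) (hr : Reduced g n (1 ≤ ·) b) (hbθ : b * theta g n ∈ depthLE g n (d + 1)) :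
    b * initialProd g n ∈ depthLE g n d := by
  have hD : initialProd g n ∈ pos g n := par_le_pos (initialProd_mem le_rfl)
  have hbD : b * initialProd g n ∈ pos g n := mul_mem hb hD
  have hg : g (n - 1) ∈ pos g n := gen_mem_pos (by omega)
  have hno : ∀ i, i + 1 < n → ∀ z ∈ pos g n, b * initialProd g n ≠ z * g i := by
    intro i hi z hz he
    obtain ⟨v, hv, h1⟩ := h.of_mul_initialProd_eq hb hz hi he
    exact hr (i + 1) hi (by omega) v hv h1
  have hr₁ : Reduced g n (1 ≤ ·) (b * theta g n) := by
    intro j hj hj1 z hz he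
    obtain ⟨k, rfl⟩ : ∃ k, j = k + 1 := ⟨j - 1, by omega⟩
    rw [theta, ← mul_assoc] at he
    obtain ⟨v, hv, h1⟩ := (h.of_mul_descProd_eq (by omega) hbD hz hj he).2.2 k rfl (by omega)
    exact hno k hj v hv h1
  have hr₂ : Reduced g n (· + 1 < n) (b * initialProd g n * g (n - 1)) := by
    intro j hj hj1 z hz he
    by_cases hadj : j + 2 = n
    · obtain ⟨v, hv, h1, -⟩ := h.lcm_adj (by omega) hj (by omega) hbD hz he
      exact hno j hj1 _ (mul_mem hv hg) h1
    · obtain ⟨v, hv, h1, -⟩ := h.lcm_far (by omega) hj (by omega) hbD hz he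
      exact hno j hj1 v hv h1
  have h1 := h.mem_of_reduced_mul_mem (mulPar_subset_pos (depthLE_subset_pos d) _)
    (h.leftDivClosed_mulPar_flip (by omega) (depthLE_subset_pos d)
      (h.leftDivClosed_depthLE (by omega) d) (depthLE_mul d))
    (mul_mem hb (theta_mem (by omega))) hr₁ (one_mem _) (by rw [mul_one]; exact hbθ)
  have h2 : b * theta g n = b * initialProd g n * g (n - 1) * descProd g (n - 2) := by
    obtain ⟨m, rfl⟩ : ∃ m, n = m + 2 := ⟨n - 2, by omega⟩
    simp [theta, descProd, mul_assoc]
  rw [h2] at h1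
  have h3 := h.mem_of_reduced_mul_mem (depthLE_subset_pos d)
    (h.leftDivClosed_depthLE (by omega) d) (mul_mem hbD hg) hr₂
    (par_mono (fun i _ hi => by omega) (descProd_mem (j := n - 2) (by omega))) h1
  exact h.leftDivClosed_depthLE (by omega) d _ hbD _ hg h3

theorem initialProd_notMem (h : IsBraidSystem g n) (hn : 0 < n) :
    initialProd g n ∉ par g n (1 ≤ ·) := by
  suffices h0 : ∀ k, k < n → initialProd g (k + 1) ∉ par g n (1 ≤ ·) by
    simpa only [Nat.sub_add_cancel hn] using h0 (n - 1) (by omega)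
  intro k hk hD
  induction k with
  | zero =>
    rw [initialProd, initialProd, one_mul] at hD
    exact Nat.not_succ_le_zero 0 (h.of_gen_mem _ 0 hk hD)
  | succ k ih =>
    exact ih (by omega) (h.of_mul_mem _ _ (par_le_pos (initialProd_mem (by omega))) _
      (gen_mem_pos hk) hD).1

theorem mul_theta_mem_depthLE_iff (h : IsBraidSystem g n) (hn : 2 ≤ n) {d : ℕ} {b : G}
    (hb : b ∈ pos g n) :
    b * theta g n ∈ depthLE g n d ↔ 2 ≤ d ∧ b ∈ depthLE g n (d - 1) := by
  constructor
  · intro hbθ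
    obtain ⟨b', hb', m, hm, hr, rfl⟩ := h.exists_reduced_mul (1 ≤ ·) hb
    have hDpos : initialProd g n ∈ pos g n := par_le_pos (initialProd_mem le_rfl)
    rw [mul_assoc, ← h.theta_mul_comm hm, ← mul_assoc,
      h.mul_right_mem_depthLE_iff (by omega) hm (mul_mem hb' (theta_mem (by omega)))] at hbθ
    have key : ∀ e, d ≤ e + 1 → b' * initialProd g n ∈ depthLE g n e := fun e he =>
      h.mul_initialProd_mem_of_reduced hn hb' hr (depthLE_mono he hbθ)
    refine ⟨?_, ?_⟩
    · by_contra hd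
      exact h.initialProd_notMem (by omega) (h.of_mul_mem _ _ hb' _ hDpos (key 0 (by omega))).2
    · rw [h.mul_right_mem_depthLE_iff (by omega) hm hb']
      exact h.leftDivClosed_depthLE (by omega) _ _ hb' _ hDpos (key (d - 1) (by omega))
  · rintro ⟨hd, hbd⟩
    obtain ⟨e, rfl⟩ : ∃ e, d = e + 2 := ⟨d - 2, by omega⟩
    exact h.mul_theta_mem_depthLE hn hbd

theorem mul_theta_pow_mem_depthLE_iff (h : IsBraidSystem g n) (hn : 2 ≤ n) {k : ℕ} (hk : 1 ≤ k)
    {d : ℕ} {b : G} (hb : b ∈ pos g n) :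
    b * theta g n ^ k ∈ depthLE g n d ↔ k + 1 ≤ d ∧ b ∈ depthLE g n (d - k) := by
  induction k, hk using Nat.le_induction generalizing d with
  | base => rw [pow_one, h.mul_theta_mem_depthLE_iff hn hb]
  | succ k hk ih =>
    rw [pow_succ, ← mul_assoc, h.mul_theta_mem_depthLE_iff hn
      (mul_mem hb (pow_mem (theta_mem (by omega)) k)), ih, Nat.sub_sub, Nat.add_comm 1 k]
    constructor
    · rintro ⟨h1, h2, h3⟩
      exact ⟨by omega, h3⟩
    · rintro ⟨h1, h3⟩
      exact ⟨by omega, by omega, h3⟩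

theorem IsReversal.map_theta {r : G → G} (hr : IsReversal g n r) (hn : 0 < n) :
    r (theta g n) = theta g n := by
  have hD : ∀ k, k < n → r (initialProd g (k + 1)) = descProd g k := by
    intro k hk
    induction k with
    | zero => simp [initialProd, descProd, hr.map_gen 0 hk]
    | succ k ih => rw [initialProd, hr.map_mul, ih (by omega), hr.map_gen _ hk, descProd]
  have h1 := hD (n - 1) (by omega)
  rw [Nat.sub_add_cancel hn] at h1
  rw [theta, hr.map_mul, h1, ← h1, hr.involutive (par_le_pos (initialProd_mem le_rfl))]

theorem theta_pow_mul_mem_depthLE_iff (h : IsBraidSystem g n) (hn : 2 ≤ n) {k : ℕ} (hk : 1 ≤ k)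
    {d : ℕ} {b : G} (hb : b ∈ pos g n) :
    theta g n ^ k * b ∈ depthLE g n d ↔ k + 1 ≤ d ∧ b ∈ depthLE g n (d - k) := by
  obtain ⟨r, hr⟩ := h.exists_isReversal
  have hpow : r (theta g n ^ k) = theta g n ^ k := by
    induction k with
    | zero => simp [hr.map_one]
    | succ k ih =>
      rcases Nat.eq_zero_or_pos k with rfl | hk0
      · simpa using hr.map_theta (by omega)
      · rw [pow_succ, hr.map_mul, ih hk0, hr.map_theta (by omega), ← pow_succ', pow_succ]
  rw [← hr.map_mem_depthLE_iff (mul_mem (pow_mem (theta_mem (by omega)) k) hb), hr.map_mul, hpow,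
    h.mul_theta_pow_mem_depthLE_iff hn hk (hr.map_par hb), hr.map_mem_depthLE_iff hb]

end IsBraidSystem

/-! ### Depth in the braid group -/

namespace PositiveBraid

open BraidOrder IsBraidSystem

theorem par_gen_one_le (n : ℕ) : par (gen n) n (1 ≤ ·) = M₁b n := by
  unfold par M₁b
  congr 1
  ext x
  exact exists_congr fun i => by tauto

theorem par_gen_add_one_lt (n : ℕ) : par (gen n) n (· + 1 < n) = Nb n := by
  unfold par Nb
  congr 1
  ext x
  refine exists_congr fun i => ⟨fun h => h.2, fun h => ⟨by omega, h⟩⟩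

theorem seg_zero (n k : ℕ) : seg n 0 k = initialProd (gen n) k := by
  induction k with
  | zero => rfl
  | succ k ih =>
    rw [initialProd, ← ih]
    simp [seg, List.range_succ]

theorem segRev_zero_succ (n k : ℕ) : segRev n 0 (k + 1) = descProd (gen n) k := by
  induction k with
  | zero => simp [segRev, descProd]
  | succ k ih =>
    rw [descProd, ← ih]
    simp [segRev, List.range_succ]

theorem thetaWordb_eq {n : ℕ} (hn : 0 < n) : thetaWordb n = theta (gen n) n := by
  obtain ⟨n, rfl⟩ := Nat.exists_eq_succ_of_ne_zero hn.ne'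
  rw [thetaWordb, theta, seg_zero, Nat.succ_eq_add_one, segRev_zero_succ, Nat.add_sub_cancel]

end PositiveBraid

namespace IsBraidSystem

variable {G : Type*} [Group G] {g : ℕ → G} {n : ℕ}

theorem dptB_congr (h : IsBraidSystem g n) (hn : 2 ≤ n) {a b : G} (ha : a ∈ pos g n)
    (hb : b ∈ pos g n) (hab : ∀ d, a ∈ depthLE g n d ↔ b ∈ depthLE g n d) :
    dptB g n a = dptB g n b :=
  eq_of_forall_ge_iff fun d => by rw [h.dpt_le_iff hn ha, h.dpt_le_iff hn hb, hab]

theorem dptB_mul_left (h : IsBraidSystem g n) (hn : 2 ≤ n) {a b : G}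
    (ha : a ∈ par g n (1 ≤ ·)) (hb : b ∈ pos g n) : dptB g n (a * b) = dptB g n b :=
  h.dptB_congr hn (mul_mem (par_le_pos ha) hb) hb fun _ =>
    h.mul_left_mem_depthLE_iff (by omega) ha hb

theorem dptB_mul_right (h : IsBraidSystem g n) (hn : 2 ≤ n) {a b : G}
    (ha : a ∈ par g n (1 ≤ ·)) (hb : b ∈ pos g n) : dptB g n (b * a) = dptB g n b :=
  h.dptB_congr hn (mul_mem hb (par_le_pos ha)) hb fun _ =>
    h.mul_right_mem_depthLE_iff (by omega) ha hb

theorem one_le_dptB (h : IsBraidSystem g n) (hn : 2 ≤ n) {b : G} (hb : b ∈ pos g n)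
    (hb₁ : b ∉ par g n (1 ≤ ·)) : 1 ≤ dptB g n b := by
  by_contra hlt
  exact hb₁ ((h.dpt_le_iff hn hb 0).1 (by omega))

theorem dptB_theta_pow_mul (h : IsBraidSystem g n) (hn : 2 ≤ n) {k : ℕ} (hk : 1 ≤ k) {b : G}
    (hb : b ∈ pos g n) : dptB g n (theta g n ^ k * b) = k + max 1 (dptB g n b) := by
  refine eq_of_forall_ge_iff fun d => ?_
  rw [h.dpt_le_iff hn (mul_mem (pow_mem (theta_mem (by omega)) k) hb),
    h.theta_pow_mul_mem_depthLE_iff hn hk hb, ← h.dpt_le_iff hn hb]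
  omega

theorem dptB_mul_theta_pow (h : IsBraidSystem g n) (hn : 2 ≤ n) {k : ℕ} (hk : 1 ≤ k) {b : G}
    (hb : b ∈ pos g n) : dptB g n (b * theta g n ^ k) = k + max 1 (dptB g n b) := by
  refine eq_of_forall_ge_iff fun d => ?_
  rw [h.dpt_le_iff hn (mul_mem hb (pow_mem (theta_mem (by omega)) k)),
    h.mul_theta_pow_mem_depthLE_iff hn hk hb, ← h.dpt_le_iff hn hb]
  omega

theorem dptB_of_mem_par (h : IsBraidSystem g n) (hn : 2 ≤ n) {a : G}
    (ha : a ∈ par g n (1 ≤ ·)) : dptB g n a = 0 :=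
  Nat.le_zero.1 ((h.dpt_le_iff hn (par_le_pos ha) 0).2 ha)

theorem dptB_theta_mul (h : IsBraidSystem g n) (hn : 2 ≤ n) {k : ℕ} (hk : 1 ≤ k) {a b : G}
    (ha : a ∈ par g n (1 ≤ ·)) (hb : b ∈ pos g n) (hb₁ : b ∉ par g n (1 ≤ ·)) :
    (dptB g n (theta g n ^ k * a * b) : ℤ) =
        (dptB g n (theta g n ^ k * a) : ℤ) + (dptB g n b : ℤ) - 1 ∧
      (dptB g n (b * (theta g n ^ k * a)) : ℤ) =
        (dptB g n (theta g n ^ k * a) : ℤ) + (dptB g n b : ℤ) - 1 := by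
  have hθ : theta g n ^ k ∈ pos g n := pow_mem (theta_mem (by omega)) k
  have hb0 := h.one_le_dptB hn hb hb₁
  rw [h.dptB_theta_pow_mul hn hk (par_le_pos ha), h.dptB_of_mem_par hn ha, mul_assoc,
    h.dptB_theta_pow_mul hn hk (mul_mem (par_le_pos ha) hb), h.dptB_mul_left hn ha hb,
    ← mul_assoc, h.dptB_mul_right hn ha (mul_mem hb hθ), h.dptB_mul_theta_pow hn hk hb]
  omega

end IsBraidSystem

open GarsideOrder BraidOrder in
/-- (1) For every `a ∈ M₁` and `b ∈ M \ M₁`, `dpt (ab) = dpt (ba) = dpt b`.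
(2) For every `a ∈ Θ` and `b ∈ M \ M₁`, `dpt (ab) = dpt (ba) = dpt a + dpt b - 1`. -/
theorem statement15 (n : ℕ) (hn : 2 ≤ n) :
    (∀ a ∈ M₁b n, ∀ b ∈ Mb n, b ∉ M₁b n →
      dpt (Mb n) (M₁b n) (Nb n) (a * b) = dpt (Mb n) (M₁b n) (Nb n) b ∧
      dpt (Mb n) (M₁b n) (Nb n) (b * a) = dpt (Mb n) (M₁b n) (Nb n) b) ∧
    (∀ a ∈ thetaSet (M₁b n) (thetaWordb n), ∀ b ∈ Mb n, b ∉ M₁b n →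
      (dpt (Mb n) (M₁b n) (Nb n) (a * b) : ℤ) =
        (dpt (Mb n) (M₁b n) (Nb n) a : ℤ) + (dpt (Mb n) (M₁b n) (Nb n) b : ℤ) - 1 ∧
      (dpt (Mb n) (M₁b n) (Nb n) (b * a) : ℤ) =
        (dpt (Mb n) (M₁b n) (Nb n) a : ℤ) + (dpt (Mb n) (M₁b n) (Nb n) b : ℤ) - 1) := by
  have h := PositiveBraid.isBraidSystem n
  simp only [PositiveBraid.thetaWordb_eq (show 0 < n by omega), ← PositiveBraid.pos_gen,
    ← PositiveBraid.par_gen_one_le, ← PositiveBraid.par_gen_add_one_lt]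
  refine ⟨fun a ha b hb _ => ⟨h.dptB_mul_left hn ha hb, h.dptB_mul_right hn ha hb⟩, ?_⟩
  rintro _ ⟨k, hk, a, ha, rfl⟩ b hb hb₁
  exact h.dptB_theta_mul hn hk ha hb hb₁
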